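/- arXiv:1204.2136 — 5 statements merged into one kernel-verified Lean document; each statement's English description precedes it below -/
import Mathlib

section
/- Privacy of the Johnson–Lindenstrauss graph-Laplacian algorithm (Theorem 3.1): Let n ≥ 2, let ε, δ ∈ (0,1), let r be a positive integer, and set w = (√(32·r·ln(2/δ))/ε)·ln(4r/δ); assume 2 ≤ w ≤ n/2. For a weighted graph ω on Fin n define the modified weights ω_H(u,v) = w/n + (1 − w/n)·ω(u,v) for u ≠ v (and ω_H(u,u) = 0), and let μ_ω be the pushforward of the standard Gaussian measure γ_{r×P} on r×P real matrices under the map M ↦ (1/r)·E_{ω_H}ᵀ Mᵀ M E_{ω_H}. Then for any two neighboring weighted graphs ω, ω′ and every measurable set S of n×n real matrices, μ_ω(S) ≤ e^ε · μ_{ω′}(S) + δ. -/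
open MeasureTheory ProbabilityTheory Matrix

noncomputable section

abbrev Pairs (n : ℕ) := {p : Fin n × Fin n // p.1 < p.2}

instance matMeas (m n : Type*) : MeasurableSpace (Matrix m n ℝ) :=
  inferInstanceAs (MeasurableSpace (m → n → ℝ))

/-- The standard Gaussian measure on `ι → ℝ`: iid standard normal coordinates. -/
def stdGaussianPi (ι : Type*) [Fintype ι] : Measure (ι → ℝ) :=
  Measure.pi fun _ => gaussianReal 0 1

instance (ι : Type*) [Fintype ι] : IsProbabilityMeasure (stdGaussianPi ι) := by
  unfold stdGaussianPi; infer_instance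

/-- The measure on `m × ι` real matrices with iid standard normal entries. -/
def stdGaussianMatrix (m ι : Type*) [Fintype m] [Fintype ι] : Measure (Matrix m ι ℝ) :=
  (Measure.pi fun _ : m => stdGaussianPi ι : Measure (m → ι → ℝ))

/-- A weighted graph: symmetric, zero diagonal, weights in `[0,1]`. -/
def IsWeightedGraph {n : ℕ} (ω : Fin n → Fin n → ℝ) : Prop :=
  (∀ u v, ω u v = ω v u) ∧ (∀ u, ω u u = 0) ∧ ∀ u v, 0 ≤ ω u v ∧ ω u v ≤ 1

/-- Two weighted graphs are neighbors if they agree except on one pair `{a,b}`. -/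
def GraphNeighbors {n : ℕ} (ω ω' : Fin n → Fin n → ℝ) : Prop :=
  ∃ a b : Fin n, a ≠ b ∧
    ∀ u v : Fin n, ({u, v} : Finset (Fin n)) ≠ {a, b} → ω u v = ω' u v

/-- The edge matrix of a weighted graph: the row indexed by `(u,v)` (with `u < v`) is
`√(ω u v) · (e_u - e_v)ᵀ`. -/
def edgeMatrix {n : ℕ} (ω : Fin n → Fin n → ℝ) : Matrix (Pairs n) (Fin n) ℝ :=
  Matrix.of fun p x =>
    Real.sqrt (ω p.1.1 p.1.2) * (if x = p.1.1 then 1 else if x = p.1.2 then -1 else 0)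

/-- The modified weights `ω_H(u,v) = w/n + (1 - w/n)·ω(u,v)` for `u ≠ v`. -/
def modWeights {n : ℕ} (w : ℝ) (ω : Fin n → Fin n → ℝ) : Fin n → Fin n → ℝ :=
  fun u v => if u = v then 0 else w / n + (1 - w / n) * ω u v

open scoped ENNReal NNReal

lemma lintegral_prod_pi_const {ι Ω : Type*} [Fintype ι] [MeasurableSpace Ω] (μ : Measure Ω)
    [IsProbabilityMeasure μ] {f : ι → Ω → ℝ≥0∞} (hf : ∀ i, Measurable (f i)) :
    ∫⁻ x, ∏ i, f i (x i) ∂(Measure.pi fun _ : ι => μ) = ∏ i, ∫⁻ x, f i x ∂μ := by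
  rw [lintegral_prod_eq_prod_lintegral_of_indepFun Finset.univ
    (fun i (x : ι → Ω) => f i (x i)) (iIndepFun_pi fun i => (hf i).aemeasurable)
    (fun i => (hf i).comp (measurable_pi_apply i))]
  refine Finset.prod_congr rfl fun i _ => ?_
  rw [← (measurePreserving_eval (fun _ : ι => μ) i).lintegral_comp (hf i)]

lemma pi_withDensity_const {ι Ω : Type*} [Fintype ι] [MeasurableSpace Ω] (μ : Measure Ω)
    [IsProbabilityMeasure μ] {u : Ω → ℝ≥0∞} (hu : Measurable u)
    [IsProbabilityMeasure (μ.withDensity u)] :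
    (Measure.pi fun _ : ι => μ.withDensity u) =
      (Measure.pi fun _ : ι => μ).withDensity fun x => ∏ i, u (x i) := by
  refine Measure.pi_eq fun s hs => ?_
  rw [withDensity_apply _ (MeasurableSet.univ_pi hs), ← lintegral_indicator (MeasurableSet.univ_pi hs)]
  have h : (Set.univ.pi s).indicator (fun x : ι → Ω => ∏ i, u (x i)) =
      fun x => ∏ i, (s i).indicator u (x i) := by
    ext x
    classical
    by_cases hx : x ∈ Set.univ.pi s
    · rw [Set.indicator_of_mem hx]
      exact Finset.prod_congr rfl fun i _ => (Set.indicator_of_mem (hx i trivial) u).symm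
    · rw [Set.indicator_of_notMem hx]
      simp only [Set.mem_pi, Set.mem_univ, true_implies, not_forall] at hx
      obtain ⟨i, hi⟩ := hx
      exact (Finset.prod_eq_zero (Finset.mem_univ i) (Set.indicator_of_notMem hi u)).symm
  rw [h, lintegral_prod_pi_const μ fun i => hu.indicator (hs i)]
  refine Finset.prod_congr rfl fun i _ => ?_
  rw [lintegral_indicator (hs i), withDensity_apply _ (hs i)]

/-- If `exp ∘ L` is the density of `P` with respect to `Q`, a bound on the exponential moment of
the log-likelihood ratio `L` gives approximate privacy for the product measures. -/
lemma pi_le_exp_mul_pi_add {ι Ω : Type*} [Fintype ι] [MeasurableSpace Ω] (P Q : Measure Ω)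
    [IsProbabilityMeasure P] [IsProbabilityMeasure Q] {L : Ω → ℝ} (hL : Measurable L)
    (hP : P = Q.withDensity fun x => ENNReal.ofReal (Real.exp (L x)))
    {l ε m : ℝ} (hl : 0 ≤ l)
    (hm : ∫⁻ x, ENNReal.ofReal (Real.exp (l * L x)) ∂P ≤ ENNReal.ofReal (Real.exp m))
    {T : Set (ι → Ω)} (hT : MeasurableSet T) :
    (Measure.pi fun _ : ι => P) T ≤
      ENNReal.ofReal (Real.exp ε) * (Measure.pi fun _ : ι => Q) T +
        ENNReal.ofReal (Real.exp (Fintype.card ι * m - l * ε)) := by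
  have hu : Measurable fun x => ENNReal.ofReal (Real.exp (L x)) := by fun_prop
  have hPi : (Measure.pi fun _ : ι => P) = (Measure.pi fun _ : ι => Q).withDensity
      fun x => ENNReal.ofReal (Real.exp (∑ i, L (x i))) := by
    subst hP
    rw [pi_withDensity_const Q hu]
    congr 1
    ext x
    rw [Real.exp_sum, ENNReal.ofReal_prod_of_nonneg fun i _ => (Real.exp_pos _).le]
  have hmom : ∫⁻ x, ENNReal.ofReal (Real.exp (l * ∑ i, L (x i) - l * ε))
      ∂(Measure.pi fun _ : ι => P) ≤ ENNReal.ofReal (Real.exp (Fintype.card ι * m - l * ε)) := by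
    have h1 : ∀ x : ι → Ω, ENNReal.ofReal (Real.exp (l * ∑ i, L (x i) - l * ε)) =
        ENNReal.ofReal (Real.exp (-(l * ε))) * ∏ i, ENNReal.ofReal (Real.exp (l * L (x i))) := by
      intro x
      rw [← ENNReal.ofReal_prod_of_nonneg fun i _ => (Real.exp_pos _).le, ← Real.exp_sum,
        ← ENNReal.ofReal_mul (Real.exp_pos _).le, ← Real.exp_add, Finset.mul_sum]
      ring_nf
    simp_rw [h1]
    rw [lintegral_const_mul _ (by fun_prop),
      lintegral_prod_pi_const P (f := fun _ x => ENNReal.ofReal (Real.exp (l * L x)))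
        (fun _ => by fun_prop), Finset.prod_const, Finset.card_univ]
    calc _ ≤ ENNReal.ofReal (Real.exp (-(l * ε))) *
          ENNReal.ofReal (Real.exp m) ^ Fintype.card ι := by gcongr
      _ = _ := by
        rw [← ENNReal.ofReal_pow (Real.exp_pos _).le, ← ENNReal.ofReal_mul (Real.exp_pos _).le,
          ← Real.exp_nat_mul, ← Real.exp_add]
        ring_nf
  have hpt : ∀ s : ℝ, Real.exp s ≤ Real.exp ε + Real.exp s * Real.exp (l * s - l * ε) := by
    intro s
    rcases le_total s ε with h | h
    · have := Real.exp_le_exp.2 h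
      have : 0 < Real.exp s * Real.exp (l * s - l * ε) := by positivity
      linarith
    · have h2 : 1 ≤ Real.exp (l * s - l * ε) := by
        rw [Real.one_le_exp_iff]
        nlinarith
      nlinarith [Real.exp_pos s, Real.exp_pos ε]
  calc (Measure.pi fun _ : ι => P) T
      = ∫⁻ x in T, ENNReal.ofReal (Real.exp (∑ i, L (x i))) ∂(Measure.pi fun _ : ι => Q) := by
        rw [hPi, withDensity_apply _ hT]
    _ ≤ ∫⁻ x in T, (ENNReal.ofReal (Real.exp ε) + ENNReal.ofReal (Real.exp (∑ i, L (x i))) *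
          ENNReal.ofReal (Real.exp (l * ∑ i, L (x i) - l * ε))) ∂(Measure.pi fun _ : ι => Q) := by
        refine lintegral_mono fun x => ?_
        rw [← ENNReal.ofReal_mul (Real.exp_pos _).le, ← ENNReal.ofReal_add (Real.exp_pos _).le
          (by positivity)]
        exact ENNReal.ofReal_le_ofReal (hpt _)
    _ ≤ ENNReal.ofReal (Real.exp ε) * (Measure.pi fun _ : ι => Q) T +
          ∫⁻ x, ENNReal.ofReal (Real.exp (∑ i, L (x i))) *
          ENNReal.ofReal (Real.exp (l * ∑ i, L (x i) - l * ε)) ∂(Measure.pi fun _ : ι => Q) := by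
        rw [lintegral_add_left measurable_const, setLIntegral_const]
        exact add_le_add le_rfl (setLIntegral_le_lintegral _ _)
    _ ≤ _ := by
        gcongr
        refine le_trans (le_of_eq ?_) hmom
        rw [hPi, lintegral_withDensity_eq_lintegral_mul _ (by fun_prop) (by fun_prop)]
        rfl

/-- The log-likelihood ratio of two centered real Gaussians. -/
def gaussianLogRatio (v v' x : ℝ) : ℝ := Real.log (v' / v) / 2 + x ^ 2 / 2 * (1 / v' - 1 / v)

lemma measurable_gaussianLogRatio (v v' : ℝ) : Measurable (gaussianLogRatio v v') := by
  unfold gaussianLogRatio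
  fun_prop

lemma gaussianReal_eq_withDensity_gaussianReal {v v' : ℝ≥0} (hv : 0 < v) (hv' : 0 < v') :
    gaussianReal 0 v = (gaussianReal 0 v').withDensity
      fun x => ENNReal.ofReal (Real.exp (gaussianLogRatio v v' x)) := by
  rw [gaussianReal_of_var_ne_zero _ hv.ne', gaussianReal_of_var_ne_zero _ hv'.ne',
    ← withDensity_mul _ (measurable_gaussianPDF _ _)
      (by have := measurable_gaussianLogRatio v v'; fun_prop)]
  congr 1
  ext x
  have hv : (0 : ℝ) < v := hv
  have hv' : (0 : ℝ) < v' := hv'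
  simp only [Pi.mul_apply, gaussianPDF, gaussianPDFReal]
  rw [← ENNReal.ofReal_mul (by positivity), gaussianLogRatio, Real.exp_add,
    Real.exp_half, Real.exp_log (by positivity)]
  congr 1
  have h1 : Real.exp (-(x - 0) ^ 2 / (2 * (v : ℝ))) =
      Real.exp (-(x - 0) ^ 2 / (2 * (v' : ℝ))) *
        Real.exp (x ^ 2 / 2 * (1 / (v' : ℝ) - 1 / v)) := by
    rw [← Real.exp_add]
    congr 1
    field_simp
    ring
  have h2 : (√(2 * Real.pi * v))⁻¹ = (√(2 * Real.pi * v'))⁻¹ * √(v' / v) := by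
    rw [← Real.sqrt_inv, ← Real.sqrt_inv, ← Real.sqrt_mul (by positivity)]
    congr 1
    field_simp
  rw [h1, h2]
  ring

lemma lintegral_exp_mul_gaussianLogRatio {v v' : ℝ≥0} (hv : 0 < v) (hv' : 0 < v') (l : ℝ)
    (hc : 0 < 1 + l * (1 - v / v' : ℝ)) :
    ∫⁻ x, ENNReal.ofReal (Real.exp (l * gaussianLogRatio v v' x)) ∂(gaussianReal 0 v) =
      ENNReal.ofReal (Real.exp
        ((l * Real.log (v' / v) - Real.log (1 + l * (1 - v / v' : ℝ))) / 2)) := by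
  have hL := measurable_gaussianLogRatio v v'
  rw [gaussianReal_of_var_ne_zero _ hv.ne',
    lintegral_withDensity_eq_lintegral_mul _ (measurable_gaussianPDF _ _) (by fun_prop)]
  have hv : (0 : ℝ) < v := hv
  have hv' : (0 : ℝ) < v' := hv'
  set c := 1 + l * (1 - v / v' : ℝ) with hcd
  have hb : 0 < c / (2 * v) := by positivity
  have h1 : ∀ x, (gaussianPDF 0 v * fun x => ENNReal.ofReal
      (Real.exp (l * gaussianLogRatio v v' x))) x = ENNReal.ofReal
      ((√(2 * Real.pi * v))⁻¹ * Real.exp (l * Real.log (v' / v) / 2) *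
        Real.exp (-(c / (2 * v)) * x ^ 2)) := by
    intro x
    simp only [Pi.mul_apply, gaussianPDF, gaussianPDFReal]
    rw [← ENNReal.ofReal_mul (by positivity), mul_assoc (√(2 * Real.pi * v))⁻¹,
      mul_assoc (√(2 * Real.pi * v))⁻¹, ← Real.exp_add, ← Real.exp_add]
    congr 3
    rw [gaussianLogRatio, hcd]
    field_simp
    ring
  simp_rw [h1]
  rw [← ofReal_integral_eq_lintegral_ofReal ((integrable_exp_neg_mul_sq hb).const_mul _)
    (ae_of_all _ fun x => by positivity), integral_const_mul, integral_gaussian]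
  congr 1
  rw [sub_div, Real.exp_sub, Real.exp_half (Real.log c), Real.exp_log hc, mul_right_comm,
    ← Real.sqrt_inv, ← Real.sqrt_mul (by positivity), div_eq_mul_inv _ (√c), ← Real.sqrt_inv,
    mul_comm]
  congr 2
  field_simp

lemma gaussian_moment_exponent_le {r l s w t : ℝ} (hr : 0 ≤ r) (hs : 4.7 ≤ s) (hrs : 22 * r ≤ s ^ 2)
    (hl : 1 ≤ l) (hw : w = s * l) (hw6 : 6 ≤ w) (ht : |t| ≤ 1) :
    0 < 1 + l * (1 - (w / 2) / (w / 2 + t)) ∧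
    r * ((l * Real.log ((w / 2 + t) / (w / 2)) -
      Real.log (1 + l * (1 - (w / 2) / (w / 2 + t)))) / 2) ≤ 1 := by
  obtain ⟨ht1, ht2⟩ := abs_le.1 ht
  have hv' : w / 3 ≤ w / 2 + t := by linarith
  have hv'0 : 0 < w / 2 + t := by linarith
  set v' := w / 2 + t with hv'd
  set y := l * t / v' with hy
  have hc : 1 + l * (1 - (w / 2) / v') = 1 + y := by
    rw [hy]
    field_simp
    rw [hv'd]
    ring
  have hyabs : |y| ≤ 3 / s := by
    rw [hy, abs_div, abs_mul, abs_of_pos hv'0, abs_of_pos (by linarith : 0 < l),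
      div_le_div_iff₀ hv'0 (by linarith)]
    calc l * |t| * s ≤ l * 1 * s := by gcongr
      _ ≤ 3 * v' := by rw [hw] at hv'; linarith
  have hs3 : 3 / s ≤ 0.64 := by
    rw [div_le_iff₀ (by linarith)]; linarith
  have hy1 : 0.36 ≤ 1 + y := by linarith [neg_abs_le y]
  rw [hc]
  refine ⟨by linarith, ?_⟩
  have hlog1 : Real.log (v' / (w / 2)) ≤ t / (w / 2) := by
    refine (Real.log_le_sub_one_of_pos (by positivity)).trans (le_of_eq ?_)
    rw [hv'd]; field_simp; ring
  have hlog2 : -Real.log (1 + y) ≤ -y + y ^ 2 / (1 + y) := by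
    have h := Real.log_le_sub_one_of_pos (inv_pos.2 (by linarith : 0 < 1 + y))
    rw [Real.log_inv] at h
    refine h.trans (le_of_eq ?_)
    have : 1 + y ≠ 0 := by linarith
    field_simp; ring
  have hy2 : y ^ 2 / (1 + y) ≤ 25 / s ^ 2 := by
    have h : y ^ 2 ≤ (3 / s) ^ 2 := sq_le_sq' (by linarith [neg_abs_le y]) ((le_abs_self y).trans hyabs)
    calc y ^ 2 / (1 + y) ≤ (3 / s) ^ 2 / 0.36 := by gcongr
      _ = 25 / s ^ 2 := by field_simp; norm_num
  have hfirst : l * (t / (w / 2)) - y ≤ 6 / s ^ 2 := by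
    have h1 : l * (t / (w / 2)) - y = l * t ^ 2 / ((w / 2) * v') := by
      rw [hy]
      field_simp
      rw [hv'd]; ring
    have ht2' : t ^ 2 ≤ 1 := by nlinarith
    rw [h1]
    calc l * t ^ 2 / ((w / 2) * v') ≤ l * 1 / ((w / 2) * (w / 3)) := by gcongr
      _ = 6 / s ^ 2 * l⁻¹ := by rw [hw]; field_simp; norm_num
      _ ≤ 6 / s ^ 2 * 1 := by gcongr; exact inv_le_one_of_one_le₀ hl
      _ = _ := mul_one _
  have hsum : l * Real.log (v' / (w / 2)) - Real.log (1 + y) ≤ 31 / s ^ 2 := by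
    have := mul_le_mul_of_nonneg_left hlog1 (by linarith : 0 ≤ l)
    have h31 : 31 / s ^ 2 = 6 / s ^ 2 + 25 / s ^ 2 := by ring
    linarith
  calc r * ((l * Real.log (v' / (w / 2)) - Real.log (1 + y)) / 2) ≤ r * ((31 / s ^ 2) / 2) := by
        gcongr
    _ ≤ 1 := by
        have : r * ((31 / s ^ 2) / 2) = 31 * r / (2 * s ^ 2) := by ring
        rw [this, div_le_one (by positivity)]
        linarith

lemma charFunDual_stdGaussianPi {ι : Type*} [Fintype ι] [DecidableEq ι]
    (L : StrongDual ℝ (ι → ℝ)) :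
    charFunDual (stdGaussianPi ι) L =
      Complex.exp (-((∑ i, L (Pi.single i 1) ^ 2 : ℝ) : ℂ) / 2) := by
  rw [charFunDual_apply, stdGaussianPi]
  have h : ∀ x : ι → ℝ, Complex.exp (L x * Complex.I) =
      ∏ i, Complex.exp (L (Pi.single i 1) * x i * Complex.I) := by
    intro x
    rw [← Complex.exp_sum, ← Finset.sum_mul]
    congr 2
    conv_lhs => rw [← Finset.univ_sum_single x]
    rw [map_sum, Complex.ofReal_sum]
    refine Finset.sum_congr rfl fun i _ => ?_
    have : Pi.single i (x i) = x i • (Pi.single i (1 : ℝ) : ι → ℝ) := by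
      rw [← Pi.single_smul, smul_eq_mul, mul_one]
    rw [this, map_smul, smul_eq_mul, Complex.ofReal_mul, mul_comm]
  simp_rw [h]
  rw [integral_fintype_prod_eq_prod
    (f := fun i (x : ℝ) => Complex.exp (L (Pi.single i 1) * x * Complex.I))]
  simp_rw [← charFun_apply_real, charFun_gaussianReal]
  rw [← Complex.exp_sum]
  congr 1
  push_cast
  rw [neg_div, Finset.sum_div, ← Finset.sum_neg_distrib]
  refine Finset.sum_congr rfl fun i _ => ?_
  simp

lemma map_stdGaussianPi_eq_map_prod {ι κ E : Type*} [Fintype ι] [Fintype κ] [DecidableEq ι]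
    [DecidableEq κ] [NormedAddCommGroup E] [NormedSpace ℝ E] [CompleteSpace E]
    [SecondCountableTopology E] [MeasurableSpace E] [BorelSpace E]
    (A : (ι → ℝ) →L[ℝ] E) (C : ((κ → ℝ) × ℝ) →L[ℝ] E) (v : ℝ≥0)
    (h : ∀ L : StrongDual ℝ E, ∑ i, L (A (Pi.single i 1)) ^ 2 =
      ∑ j, L (C (Pi.single j 1, 0)) ^ 2 + v * L (C (0, 1)) ^ 2) :
    (stdGaussianPi ι).map A = ((stdGaussianPi κ).prod (gaussianReal 0 v)).map C := by
  have := Measure.isProbabilityMeasure_map (μ := stdGaussianPi ι) A.continuous.aemeasurable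
  have := Measure.isProbabilityMeasure_map (μ := (stdGaussianPi κ).prod (gaussianReal 0 v))
    C.continuous.measurable.aemeasurable
  refine Measure.ext_of_charFunDual ?_
  ext L
  rw [charFunDual_map, charFunDual_map, charFunDual_prod, charFunDual_stdGaussianPi,
    charFunDual_stdGaussianPi, charFunDual_eq_charFun_map_one, gaussianReal_map_continuousLinearMap,
    charFun_gaussianReal, ← Complex.exp_add]
  congr 1
  have h' := h L
  simp only [ContinuousLinearMap.comp_apply, ContinuousLinearMap.inl_apply,
    ContinuousLinearMap.inr_apply] at h' ⊢
  rw [h']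
  simp [max_eq_left (sq_nonneg _), Prod.mk_zero_zero]
  ring

section GraphEnergy

variable {n : ℕ}

/-- The quadratic form of the Laplacian of a weighted graph. -/
def graphEnergy (ω : Fin n → Fin n → ℝ) (x : Fin n → ℝ) : ℝ :=
  ∑ p : Pairs n, ω p.1.1 p.1.2 * (x p.1.1 - x p.1.2) ^ 2

lemma two_mul_sum_pairs (x : Fin n → ℝ) :
    2 * ∑ p : Pairs n, (x p.1.1 - x p.1.2) ^ 2 = ∑ u, ∑ v, (x u - x v) ^ 2 := by
  have h1 : ∑ p : Pairs n, (x p.1.1 - x p.1.2) ^ 2 =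
      ∑ p : Fin n × Fin n, if p.1 < p.2 then (x p.1 - x p.2) ^ 2 else 0 := by
    rw [← Finset.sum_filter]
    exact (Finset.sum_subtype _ (by simp) fun p : Fin n × Fin n => (x p.1 - x p.2) ^ 2).symm
  have h2 : (∑ p : Fin n × Fin n, if p.1 < p.2 then (x p.1 - x p.2) ^ 2 else 0) =
      ∑ p : Fin n × Fin n, if p.2 < p.1 then (x p.1 - x p.2) ^ 2 else 0 := by
    rw [← (Equiv.prodComm (Fin n) (Fin n)).sum_comp]
    refine Finset.sum_congr rfl fun p _ => ?_
    exact if_congr Iff.rfl (sub_sq_comm _ _) rfl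
  rw [← Fintype.sum_prod_type' fun u v => (x u - x v) ^ 2, two_mul]
  nth_rewrite 2 [h1]
  rw [h2, h1, ← Finset.sum_add_distrib]
  refine Finset.sum_congr rfl fun p _ => ?_
  rcases lt_trichotomy p.1 p.2 with h | h | h
  · simp [h, h.not_gt]
  · simp [h]
  · simp [h, h.not_gt]

lemma nat_mul_sub_sq_le_sum (x : Fin n → ℝ) {a b : Fin n} (hab : a ≠ b) :
    n * (x a - x b) ^ 2 ≤ ∑ u, ∑ v, (x u - x v) ^ 2 := by
  set d := x a - x b with hd
  set y : Fin n → ℝ := Pi.single a 1 - Pi.single b 1 with hy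
  have hy1 : ∑ u, y u = 0 := by simp [hy]
  have hy2 : ∑ u, y u ^ 2 = 2 := by
    have : ∀ u, y u ^ 2 = (Pi.single a (1 : ℝ) : Fin n → ℝ) u + (Pi.single b (1 : ℝ) : Fin n → ℝ) u := by
      intro u
      simp only [hy, Pi.sub_apply, Pi.single_apply]
      split_ifs <;> simp_all
    simp_rw [this, Finset.sum_add_distrib]
    norm_num
  have hxy : ∑ u, x u * y u = d := by
    simp [hy, mul_sub, Pi.single_apply, hd]
  have hpoint : ∀ u v, (x u - x v) ^ 2 - ((x u - d / 2 * y u) - (x v - d / 2 * y v)) ^ 2 =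
      d * (x u * y u) + d * (x v * y v) - d * x u * y v - d * y u * x v
        - d ^ 2 / 4 * y u ^ 2 - d ^ 2 / 4 * y v ^ 2 + d ^ 2 / 2 * y u * y v := by
    intro u v
    ring
  have hdiff : ∑ u, ∑ v, ((x u - x v) ^ 2 - ((x u - d / 2 * y u) - (x v - d / 2 * y v)) ^ 2) =
      n * d ^ 2 := by
    simp_rw [hpoint]
    simp only [Finset.sum_add_distrib, Finset.sum_sub_distrib, ← Finset.mul_sum, ← Finset.sum_mul,
      Finset.sum_const, Finset.card_univ, Fintype.card_fin, nsmul_eq_mul, hy1, hy2, hxy]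
    simp_rw [mul_left_comm (x _) (n : ℝ), ← Finset.mul_sum, hxy]
    ring
  rw [← hdiff]
  exact Finset.sum_le_sum fun u _ => Finset.sum_le_sum fun v _ => sub_le_self _ (sq_nonneg _)

lemma half_mul_sub_sq_le_graphEnergy {ω : Fin n → Fin n → ℝ} {c : ℝ} (hc : 0 ≤ c)
    (hω : ∀ u v, u ≠ v → c / n ≤ ω u v) (x : Fin n → ℝ) {a b : Fin n} (hab : a ≠ b) :
    c / 2 * (x a - x b) ^ 2 ≤ graphEnergy ω x := by
  have hn : (0 : ℝ) < n := by exact_mod_cast a.pos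
  calc c / 2 * (x a - x b) ^ 2 = c / n * (n * (x a - x b) ^ 2 / 2) := by field_simp
    _ ≤ c / n * ∑ p : Pairs n, (x p.1.1 - x p.1.2) ^ 2 := by
        gcongr
        linarith [two_mul_sum_pairs x, nat_mul_sub_sq_le_sum x hab]
    _ ≤ graphEnergy ω x := by
        rw [graphEnergy, Finset.mul_sum]
        refine Finset.sum_le_sum fun p _ => ?_
        gcongr
        exact hω _ _ p.2.ne

lemma edgeMatrix_row (ω : Fin n → Fin n → ℝ) (p : Pairs n) :
    edgeMatrix ω p = √(ω p.1.1 p.1.2) • (Pi.single p.1.1 1 - Pi.single p.1.2 1) := by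
  ext z
  have := p.2.ne
  simp only [edgeMatrix, Matrix.of_apply, Pi.smul_apply, Pi.sub_apply, Pi.single_apply,
    smul_eq_mul]
  split_ifs <;> simp_all

lemma sum_sq_edgeMatrix_mulVec {ω : Fin n → Fin n → ℝ} (hω : ∀ u v, 0 ≤ ω u v) (x : Fin n → ℝ) :
    ∑ p, (edgeMatrix ω *ᵥ x) p ^ 2 = graphEnergy ω x := by
  refine Finset.sum_congr rfl fun p _ => ?_
  rw [Matrix.mulVec, edgeMatrix_row, smul_dotProduct, sub_dotProduct, single_one_dotProduct,
    single_one_dotProduct, smul_eq_mul, mul_pow, Real.sq_sqrt (hω _ _)]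

/-- A weighted graph all of whose weights are at least `c / n` keeps a nonnegative energy after
removing conductance `c / 2` between two vertices. -/
lemma exists_graphEnergy_eq_add_sum {ω : Fin n → Fin n → ℝ} {c : ℝ} (hc : 0 ≤ c)
    (hω0 : ∀ u v, 0 ≤ ω u v) (hω : ∀ u v, u ≠ v → c / n ≤ ω u v) {a b : Fin n} (hab : a ≠ b) :
    ∃ (m : ℕ) (y : Fin m → Fin n → ℝ), ∀ x,
      graphEnergy ω x = ∑ j, (y j ⬝ᵥ x) ^ 2 + c / 2 * (x a - x b) ^ 2 := by
  set β : Fin n → ℝ := Pi.single a 1 - Pi.single b 1 with hβ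
  have hβx : ∀ x : Fin n → ℝ, β ⬝ᵥ x = x a - x b := by
    intro x
    rw [hβ, sub_dotProduct, single_one_dotProduct, single_one_dotProduct]
  have hquad : ∀ x : Fin n → ℝ,
      x ⬝ᵥ (((edgeMatrix ω)ᵀ * edgeMatrix ω - (c / 2) • vecMulVec β β) *ᵥ x) =
      graphEnergy ω x - c / 2 * (x a - x b) ^ 2 := by
    intro x
    rw [sub_mulVec, dotProduct_sub, ← mulVec_mulVec, dotProduct_mulVec, vecMul_transpose,
      smul_mulVec, vecMulVec_mulVec, dotProduct_smul, hβx, ← sum_sq_edgeMatrix_mulVec hω0]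
    simp only [dotProduct_smul, dotProduct_comm x β, hβx]
    simp [dotProduct, pow_two]
  have hpsd : ((edgeMatrix ω)ᵀ * edgeMatrix ω - (c / 2) • vecMulVec β β).PosSemidef := by
    refine Matrix.PosSemidef.of_dotProduct_mulVec_nonneg ?_ fun x => ?_
    · ext i j
      simp [Matrix.mul_apply, vecMulVec_apply, mul_comm]
    · rw [star_trivial, hquad]
      linarith [half_mul_sub_sq_le_graphEnergy hc hω x hab]
  obtain ⟨m, y, hy⟩ := Matrix.posSemidef_iff_eq_sum_vecMulVec.1 hpsd
  refine ⟨m, y, fun x => ?_⟩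
  have h := hquad x
  rw [hy, sum_mulVec, dotProduct_sum] at h
  simp only [star_trivial, vecMulVec_mulVec] at h
  rw [← sub_eq_iff_eq_add, ← h]
  refine Finset.sum_congr rfl fun j _ => ?_
  simp [dotProduct_comm x, pow_two]

end GraphEnergy

section Mechanism

variable {n m : ℕ}

/-- The linear map sending `(g, h)` to `∑ j, g j • y j + h • (e_a - e_b)`. -/
def addEdgeCLM (y : Fin m → Fin n → ℝ) (a b : Fin n) : ((Fin m → ℝ) × ℝ) →L[ℝ] (Fin n → ℝ) :=
  LinearMap.toContinuousLinearMap
    ((Matrix.vecMulLinear (Matrix.of y)).comp (LinearMap.fst ℝ _ _) +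
      (LinearMap.toSpanSingleton ℝ _ (Pi.single a 1 - Pi.single b 1)).comp (LinearMap.snd ℝ _ _))

lemma strongDual_apply_eq_dotProduct (L : StrongDual ℝ (Fin n → ℝ)) (z : Fin n → ℝ) :
    L z = z ⬝ᵥ fun u => L (Pi.single u 1) := by
  conv_lhs => rw [pi_eq_sum_univ' z]
  simp [dotProduct, map_sum]

lemma map_vecMul_edgeMatrix {ω : Fin n → Fin n → ℝ} (hω : ∀ u v, 0 ≤ ω u v)
    {y : Fin m → Fin n → ℝ} {a b : Fin n} {v : ℝ≥0}
    (h : ∀ x, graphEnergy ω x = ∑ j, (y j ⬝ᵥ x) ^ 2 + v * (x a - x b) ^ 2) :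
    (stdGaussianPi (Pairs n)).map (fun g => g ᵥ* edgeMatrix ω) =
      ((stdGaussianPi (Fin m)).prod (gaussianReal 0 v)).map (addEdgeCLM y a b) := by
  refine map_stdGaussianPi_eq_map_prod
    (LinearMap.toContinuousLinearMap (Matrix.vecMulLinear (edgeMatrix ω))) _ v fun L => ?_
  have h1 : ∀ p, L (LinearMap.toContinuousLinearMap (Matrix.vecMulLinear (edgeMatrix ω))
      (Pi.single p 1)) = (edgeMatrix ω *ᵥ fun u => L (Pi.single u 1)) p := by
    intro p
    rw [strongDual_apply_eq_dotProduct]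
    simp [Matrix.mulVec, Matrix.row]
  have h2 : ∀ j, L (addEdgeCLM y a b (Pi.single j 1, 0)) =
      y j ⬝ᵥ fun u => L (Pi.single u 1) := by
    intro j
    rw [strongDual_apply_eq_dotProduct]
    simp [addEdgeCLM, Matrix.row]
    rfl
  have h3 : L (addEdgeCLM y a b (0, 1)) = L (Pi.single a 1) - L (Pi.single b 1) := by
    simp [addEdgeCLM]
  simp_rw [h1, h2, h3, sum_sq_edgeMatrix_mulVec hω, h]

/-- The normalized Gram matrix of the images of `r` independent Gaussian vectors. -/
def gramMechanism (r : ℕ) (y : Fin m → Fin n → ℝ) (a b : Fin n)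
    (q : Fin r → (Fin m → ℝ) × ℝ) : Matrix (Fin n) (Fin n) ℝ :=
  (r : ℝ)⁻¹ • ((Matrix.of fun i => addEdgeCLM y a b (q i))ᵀ *
    Matrix.of fun i => addEdgeCLM y a b (q i))

lemma measurable_gram (r : ℕ) :
    Measurable fun Y : Fin r → Fin n → ℝ => (r : ℝ)⁻¹ • ((Matrix.of Y)ᵀ * Matrix.of Y) := by
  refine measurable_pi_lambda _ fun i => measurable_pi_lambda _ fun j => ?_
  simp only [Matrix.smul_apply, Matrix.mul_apply, Matrix.transpose_apply, Matrix.of_apply]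
  fun_prop

lemma measurable_gramMechanism (r : ℕ) (y : Fin m → Fin n → ℝ) (a b : Fin n) :
    Measurable (gramMechanism r y a b) := by
  have : Measurable fun (q : Fin r → (Fin m → ℝ) × ℝ) i => addEdgeCLM y a b (q i) := by fun_prop
  exact (measurable_gram r).comp this

lemma map_mechanism_eq_map_gramMechanism {r : ℕ} {ω : Fin n → Fin n → ℝ}
    (hω : ∀ u v, 0 ≤ ω u v) {y : Fin m → Fin n → ℝ} {a b : Fin n} {v : ℝ≥0}
    (h : ∀ x, graphEnergy ω x = ∑ j, (y j ⬝ᵥ x) ^ 2 + v * (x a - x b) ^ 2) :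
    Measure.map (fun M : Matrix (Fin r) (Pairs n) ℝ =>
        ((r : ℝ)⁻¹) • ((edgeMatrix ω)ᵀ * Mᵀ * M * edgeMatrix ω))
      (stdGaussianMatrix (Fin r) (Pairs n)) =
    (Measure.pi fun _ : Fin r => (stdGaussianPi (Fin m)).prod (gaussianReal 0 v)).map
      (gramMechanism r y a b) := by
  have hE : Measurable fun g : Pairs n → ℝ => g ᵥ* edgeMatrix ω :=
    (LinearMap.toContinuousLinearMap (Matrix.vecMulLinear (edgeMatrix ω))).continuous.measurable
  have hC : Measurable (addEdgeCLM y a b) := (addEdgeCLM y a b).continuous.measurable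
  have hp1 := Measure.isProbabilityMeasure_map (μ := stdGaussianPi (Pairs n)) hE.aemeasurable
  have hp2 := Measure.isProbabilityMeasure_map
    (μ := (stdGaussianPi (Fin m)).prod (gaussianReal 0 v)) hC.aemeasurable
  have h1 : (fun M : Matrix (Fin r) (Pairs n) ℝ =>
      ((r : ℝ)⁻¹) • ((edgeMatrix ω)ᵀ * Mᵀ * M * edgeMatrix ω)) =
      (fun Y : Fin r → Fin n → ℝ => (r : ℝ)⁻¹ • ((Matrix.of Y)ᵀ * Matrix.of Y)) ∘
        fun (M : Fin r → Pairs n → ℝ) i => M i ᵥ* edgeMatrix ω := by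
    ext1 M
    change _ = (r : ℝ)⁻¹ • ((M * edgeMatrix ω)ᵀ * (M * edgeMatrix ω))
    rw [Matrix.transpose_mul, Matrix.mul_assoc _ M]
  have h2 : gramMechanism r y a b =
      (fun Y : Fin r → Fin n → ℝ => (r : ℝ)⁻¹ • ((Matrix.of Y)ᵀ * Matrix.of Y)) ∘
        fun q i => addEdgeCLM y a b (q i) := rfl
  have h3 : Measure.map (fun (M : Fin r → Pairs n → ℝ) i => M i ᵥ* edgeMatrix ω)
      (Measure.pi fun _ : Fin r => stdGaussianPi (Pairs n)) =
      Measure.map (fun q i => addEdgeCLM y a b (q i))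
        (Measure.pi fun _ : Fin r => (stdGaussianPi (Fin m)).prod (gaussianReal 0 v)) := by
    rw [Measure.pi_map_pi fun _ => hE.aemeasurable, Measure.pi_map_pi fun _ => hC.aemeasurable]
    simp_rw [map_vecMul_edgeMatrix hω h]
  rw [h1, h2, ← Measure.map_map (measurable_gram r)
    (measurable_pi_lambda _ fun i => hC.comp (measurable_pi_apply i) :
      Measurable fun (q : Fin r → (Fin m → ℝ) × ℝ) i => addEdgeCLM y a b (q i)), ← h3]
  exact (Measure.map_map (measurable_gram r)
    (measurable_pi_lambda _ fun i => hE.comp (measurable_pi_apply i))).symm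

end Mechanism

lemma modWeights_mem_Icc {n : ℕ} {w : ℝ} (hwn : w ≤ n) {ω : Fin n → Fin n → ℝ}
    (hω : IsWeightedGraph ω) {u v : Fin n} (huv : u ≠ v) :
    modWeights w ω u v ∈ Set.Icc (w / n) 1 := by
  have hn : (0 : ℝ) < n := by exact_mod_cast u.pos
  have h1 : w / n ≤ 1 := (div_le_one hn).2 hwn
  obtain ⟨h2, h3⟩ := hω.2.2 u v
  rw [modWeights, if_neg huv]
  constructor
  · nlinarith
  · nlinarith

lemma modWeights_nonneg {n : ℕ} {w : ℝ} (hw : 0 ≤ w) (hwn : w ≤ n) {ω : Fin n → Fin n → ℝ}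
    (hω : IsWeightedGraph ω) (u v : Fin n) : 0 ≤ modWeights w ω u v := by
  by_cases h : u = v
  · simp [modWeights, h]
  · exact (div_nonneg hw n.cast_nonneg).trans (modWeights_mem_Icc hwn hω h).1

lemma GraphNeighbors.exists_pair {n : ℕ} {ω ω' : Fin n → Fin n → ℝ} (h : GraphNeighbors ω ω') :
    ∃ p : Pairs n, ∀ p' : Pairs n, p' ≠ p → ω p'.1.1 p'.1.2 = ω' p'.1.1 p'.1.2 := by
  obtain ⟨a, b, hab, h⟩ := h
  wlog hlt : a < b generalizing a b
  · exact this b a hab.symm (fun u v huv => h u v (by rwa [Finset.pair_comm a b]))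
      (lt_of_le_of_ne (not_lt.1 hlt) hab.symm)
  refine ⟨⟨(a, b), hlt⟩, fun p' hp' => h _ _ fun heq => hp' ?_⟩
  obtain ⟨⟨u, v⟩, huv⟩ := p'
  have huv' : u < v := huv
  have hset : ({u, v} : Set (Fin n)) = {a, b} := by
    rw [← Finset.coe_pair, heq, Finset.coe_pair]
  rcases Set.pair_eq_pair_iff.1 hset with ⟨h1, h2⟩ | ⟨h1, h2⟩
  · subst h1 h2; rfl
  · subst h1 h2; exact absurd huv' hlt.not_gt

/-- Theorem 3.1: the JL graph-Laplacian algorithm preserves `(ε,δ)`-differential privacy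
with respect to edge changes. -/
theorem jl_laplacian_privacy {n : ℕ} (hn : 2 ≤ n) {ε δ : ℝ}
    (hε : 0 < ε ∧ ε < 1) (hδ : 0 < δ ∧ δ < 1) {r : ℕ} (hr : 0 < r) {w : ℝ}
    (hw : w = Real.sqrt (32 * r * Real.log (2 / δ)) / ε * Real.log (4 * r / δ))
    (hw2 : 2 ≤ w) (hwn : w ≤ n / 2)
    {ω ω' : Fin n → Fin n → ℝ}
    (hω : IsWeightedGraph ω) (hω' : IsWeightedGraph ω') (hnb : GraphNeighbors ω ω')
    {S : Set (Matrix (Fin n) (Fin n) ℝ)} (hS : MeasurableSet S) :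
    Measure.map (fun M : Matrix (Fin r) (Pairs n) ℝ =>
        ((r : ℝ)⁻¹) • ((edgeMatrix (modWeights w ω))ᵀ * Mᵀ * M * edgeMatrix (modWeights w ω)))
      (stdGaussianMatrix (Fin r) (Pairs n)) S
    ≤ ENNReal.ofReal (Real.exp ε) *
      Measure.map (fun M : Matrix (Fin r) (Pairs n) ℝ =>
          ((r : ℝ)⁻¹) • ((edgeMatrix (modWeights w ω'))ᵀ * Mᵀ * M * edgeMatrix (modWeights w ω')))
        (stdGaussianMatrix (Fin r) (Pairs n)) S
    + ENNReal.ofReal δ := by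
  obtain ⟨hε0, hε1⟩ := hε
  obtain ⟨hδ0, hδ1⟩ := hδ
  have hr1 : (1 : ℝ) ≤ r := by exact_mod_cast hr
  have hlog2 := Real.log_two_gt_d9
  have hlog4 : (1.38 : ℝ) ≤ Real.log (4 * r) := by
    have h4 : Real.log 4 = 2 * Real.log 2 := by
      rw [show (4 : ℝ) = 2 ^ 2 by norm_num, Real.log_pow]
      norm_num
    have := Real.log_le_log (by norm_num) (by linarith : (4 : ℝ) ≤ 4 * r)
    linarith
  have hlogδ : Real.log δ ≤ 0 := Real.log_nonpos hδ0.le hδ1.le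
  have hK : Real.log (4 * r / δ) = Real.log (4 * r) - Real.log δ :=
    Real.log_div (by positivity) hδ0.ne'
  have hl2 : Real.log (2 / δ) = Real.log 2 - Real.log δ := Real.log_div two_ne_zero hδ0.ne'
  set s := Real.sqrt (32 * r * Real.log (2 / δ)) with hs
  set l := Real.log (4 * r / δ) / ε with hl
  have hrs : 22.09 * r ≤ s ^ 2 := by
    rw [hs, Real.sq_sqrt (by rw [hl2]; apply mul_nonneg <;> linarith), hl2]
    nlinarith
  have hs47 : 4.7 ≤ s := by
    refine Real.le_sqrt_of_sq_le ?_
    rw [hl2]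
    nlinarith
  have hl138 : 1.38 ≤ l := by
    rw [hl, le_div_iff₀ hε0, hK]
    nlinarith
  have hwsl : w = s * l := by
    rw [hw, hl]
    ring
  have hw6 : 6 ≤ w := by
    rw [hwsl]
    nlinarith
  have hwn' : w ≤ n := by
    have : (0 : ℝ) ≤ n := n.cast_nonneg
    linarith
  have hw0 : 0 ≤ w := by linarith
  obtain ⟨p, hp⟩ := hnb.exists_pair
  have hpne : p.1.1 ≠ p.1.2 := p.2.ne
  set t := modWeights w ω' p.1.1 p.1.2 - modWeights w ω p.1.1 p.1.2 with ht
  have ht1 : |t| ≤ 1 := by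
    have h1 := modWeights_mem_Icc hwn' hω hpne
    have h2 := modWeights_mem_Icc hwn' hω' hpne
    have h0 : 0 ≤ w / n := by positivity
    rw [ht, abs_le]
    constructor <;> linarith [h1.1, h1.2, h2.1, h2.2]
  obtain ⟨ht2, ht3⟩ := abs_le.1 ht1
  have hnn := modWeights_nonneg hw0 hwn' hω
  have hnn' := modWeights_nonneg hw0 hwn' hω'
  obtain ⟨m, y, hy⟩ := exists_graphEnergy_eq_add_sum hw0 hnn
    (fun u v huv => (modWeights_mem_Icc hwn' hω huv).1) hpne
  have hy' : ∀ x, graphEnergy (modWeights w ω') x =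
      ∑ j, (y j ⬝ᵥ x) ^ 2 + (w / 2 + t) * (x p.1.1 - x p.1.2) ^ 2 := by
    intro x
    have h1 : graphEnergy (modWeights w ω') x - graphEnergy (modWeights w ω) x =
        t * (x p.1.1 - x p.1.2) ^ 2 := by
      rw [graphEnergy, graphEnergy, ← Finset.sum_sub_distrib, Finset.sum_eq_single p, ht, sub_mul]
      · intro p' _ hp'
        simp [modWeights, hp p' hp']
      · simp
    linarith [hy x]
  set v : ℝ≥0 := ⟨w / 2, by linarith⟩ with hv
  set v' : ℝ≥0 := ⟨w / 2 + t, by linarith⟩ with hv'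
  have hv0 : 0 < v := by
    rw [← NNReal.coe_pos]
    exact (by linarith : 0 < w / 2)
  have hv'0 : 0 < v' := by
    rw [← NNReal.coe_pos]
    exact (by linarith : 0 < w / 2 + t)
  rw [map_mechanism_eq_map_gramMechanism (v := v) hnn hy,
    map_mechanism_eq_map_gramMechanism (v := v') hnn' hy',
    Measure.map_apply (measurable_gramMechanism _ _ _ _) hS,
    Measure.map_apply (measurable_gramMechanism _ _ _ _) hS]
  obtain ⟨hc, hexp⟩ := gaussian_moment_exponent_le (r := r) (by linarith) hs47 (by linarith)
    (by linarith) hwsl hw6 ht1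
  have hL := (measurable_gaussianLogRatio v v').comp
    (measurable_snd : Measurable (Prod.snd : (Fin m → ℝ) × ℝ → ℝ))
  have hP : (stdGaussianPi (Fin m)).prod (gaussianReal 0 v) =
      ((stdGaussianPi (Fin m)).prod (gaussianReal 0 v')).withDensity
        fun q => ENNReal.ofReal (Real.exp ((gaussianLogRatio v v' ∘ Prod.snd) q)) := by
    have := measurable_gaussianLogRatio v v'
    rw [gaussianReal_eq_withDensity_gaussianReal hv0 hv'0, prod_withDensity_right (by fun_prop)]
    rfl
  have hm : ∫⁻ q, ENNReal.ofReal (Real.exp (l * (gaussianLogRatio v v' ∘ Prod.snd) q))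
      ∂((stdGaussianPi (Fin m)).prod (gaussianReal 0 v)) ≤ ENNReal.ofReal (Real.exp
        ((l * Real.log (v' / v) - Real.log (1 + l * (1 - v / v' : ℝ))) / 2)) := by
    rw [← lintegral_exp_mul_gaussianLogRatio hv0 hv'0 l hc]
    have := measurable_gaussianLogRatio v v'
    refine le_of_eq ?_
    exact measurePreserving_snd.lintegral_comp
      (f := fun x => ENNReal.ofReal (Real.exp (l * gaussianLogRatio v v' x))) (by fun_prop)
  refine (pi_le_exp_mul_pi_add _ _ hL hP (ε := ε) (by linarith) hm
    (measurable_gramMechanism r y _ _ hS)).trans ?_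
  gcongr
  rw [← Real.le_log_iff_exp_le hδ0, Fintype.card_fin]
  have hlε : l * ε = Real.log (4 * r) - Real.log δ := by
    rw [hl, div_mul_cancel₀ _ hε0.ne', hK]
  have hexp' : (r : ℝ) * ((l * Real.log (v' / v) - Real.log (1 + l * (1 - v / v' : ℝ))) / 2) ≤ 1 :=
    hexp
  linarith
end
end

section
/- Utility for cut queries (Theorem 3.2): Let n ≥ 2, let ω be a weighted graph on Fin n, let 0 < w ≤ n/2, 0 < η < 1/2, and let r be a positive integer. Define ω_H(u,v) = w/n + (1 − w/n)·ω(u,v) for u ≠ v. For an r×P real matrix M set L̃(M) = (1/r)·E_{ω_H}ᵀ Mᵀ M E_{ω_H}, and for a nonempty proper subset S ⊆ Fin n with s = |S| set R_S(M) = (1/(1 − w/n))·(1_Sᵀ L̃(M) 1_S − w·s·(n−s)/n). Then γ_{r×P}{ M : (1−η)·Φ_ω(S) − 2ηws ≤ R_S(M) ≤ (1+η)·Φ_ω(S) + 2ηws } ≥ 1 − 2·exp(−η²r/8). -/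
open MeasureTheory ProbabilityTheory Matrix

noncomputable section

/-- A unit linear combination of iid standard normals is standard normal. -/
lemma measurePreserving_dotProduct {ι : Type*} [Fintype ι] {a : ι → ℝ} (ha : a ⬝ᵥ a = 1) :
    MeasurePreserving (fun x : ι → ℝ => x ⬝ᵥ a) (stdGaussianPi ι) (gaussianReal 0 1) := by
  have hm : Measurable (fun x : ι → ℝ => x ⬝ᵥ a) := by
    unfold dotProduct; fun_prop
  refine ⟨hm, ?_⟩
  have := Measure.isProbabilityMeasure_map (μ := stdGaussianPi ι) hm.aemeasurable
  apply Measure.ext_of_charFun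
  ext t
  rw [charFun_gaussianReal, charFun_apply_real, integral_map hm.aemeasurable (by fun_prop)]
  have key : ∀ x : ι → ℝ, Complex.exp (t * ((x ⬝ᵥ a : ℝ) : ℂ) * Complex.I)
      = ∏ j, Complex.exp (((t * a j : ℝ) : ℂ) * (x j : ℂ) * Complex.I) := by
    intro x
    rw [← Complex.exp_sum, ← Finset.sum_mul]
    congr 2
    simp only [dotProduct, Complex.ofReal_sum, Complex.ofReal_mul, Finset.mul_sum]
    exact Finset.sum_congr rfl fun j _ => by ring
  simp_rw [key]
  unfold stdGaussianPi
  rw [integral_fintype_prod_eq_prod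
    (f := fun j (y : ℝ) => Complex.exp (((t * a j : ℝ) : ℂ) * (y : ℂ) * Complex.I))]
  simp_rw [← charFun_apply_real, charFun_gaussianReal]
  rw [← Complex.exp_sum]
  congr 1
  have h2 : ∑ j, (a j : ℂ) ^ 2 = 1 := by
    have := congrArg (fun y : ℝ => (y : ℂ)) ha
    simpa [dotProduct, pow_two] using this
  calc _ = ∑ j, (-(t : ℂ) ^ 2 / 2) * (a j : ℂ) ^ 2 :=
        Finset.sum_congr rfl fun j _ => by push_cast; ring
    _ = _ := by rw [← Finset.mul_sum, h2]; push_cast; ring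

lemma integral_exp_mul_sq_gaussianReal (t : ℝ) :
    ∫ x, Real.exp (t * x ^ 2) ∂(gaussianReal 0 1) = √((1 - 2 * t)⁻¹) := by
  rw [integral_gaussianReal_eq_integral_smul one_ne_zero]
  have h : ∀ x : ℝ, gaussianPDFReal 0 1 x • Real.exp (t * x ^ 2)
      = (√(2 * Real.pi))⁻¹ * Real.exp (-(1 / 2 - t) * x ^ 2) := by
    intro x
    simp only [gaussianPDFReal, smul_eq_mul, NNReal.coe_one, mul_one, sub_zero]
    rw [mul_assoc, ← Real.exp_add]
    congr 2
    ring
  simp_rw [h]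
  rw [integral_const_mul, integral_gaussian, ← Real.sqrt_inv, ← Real.sqrt_mul (by positivity)]
  congr 1
  have hpi := Real.pi_ne_zero
  rw [show (1 : ℝ) / 2 - t = (1 - 2 * t) / 2 by ring, div_div_eq_mul_div, div_eq_mul_inv]
  field_simp

/-- The moment generating function of the chi-squared distribution. -/
lemma mgf_sum_sq_stdGaussianPi (ι : Type*) [Fintype ι] (t : ℝ) :
    mgf (fun z : ι → ℝ => ∑ i, z i ^ 2) (stdGaussianPi ι) t
      = √((1 - 2 * t)⁻¹) ^ Fintype.card ι := by
  simp only [mgf, Finset.mul_sum, Real.exp_sum, stdGaussianPi]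
  rw [integral_fintype_prod_eq_prod (f := fun _ (y : ℝ) => Real.exp (t * y ^ 2))]
  simp [integral_exp_mul_sq_gaussianReal]

lemma integrable_exp_mul_sum_sq_stdGaussianPi (ι : Type*) [Fintype ι] {t : ℝ} (ht : t < 1 / 2) :
    Integrable (fun z : ι → ℝ => Real.exp (t * ∑ i, z i ^ 2)) (stdGaussianPi ι) := by
  by_contra h
  have h0 := mgf_undef h
  rw [mgf_sum_sq_stdGaussianPi] at h0
  have : 0 < √((1 - 2 * t)⁻¹) := Real.sqrt_pos.2 (inv_pos.2 (by linarith))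
  exact (pow_pos this _).ne' h0

lemma one_add_le_exp_sub_sq {x : ℝ} (h0 : 0 ≤ x) (h1 : x ≤ 1) :
    1 + x ≤ Real.exp (x - x ^ 2 / 4) := by
  have h := Real.quadratic_le_exp_of_nonneg (x := x - x ^ 2 / 4) (by nlinarith)
  nlinarith [mul_nonneg (sq_nonneg x) (sub_nonneg.2 h1), sq_nonneg (x ^ 2)]

lemma one_sub_le_exp_neg_sub_sq {x : ℝ} (h0 : 0 ≤ x) (h1 : x < 1) :
    1 - x ≤ Real.exp (-x - x ^ 2 / 4) := by
  have h := Real.hasSum_pow_div_log_of_abs_lt_one (x := x) (by rwa [abs_of_nonneg h0])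
  have h2 := sum_le_hasSum (Finset.range 2) (fun i _ => by positivity) h
  simp [Finset.sum_range_succ] at h2
  rw [← Real.log_le_iff_le_exp (by linarith)]
  nlinarith [sq_nonneg x]

lemma sqrt_pow_mul_exp_le {b c x : ℝ} (r : ℕ) (h : b ≤ Real.exp (c - x)) :
    Real.exp (-(c / 2) * r) * √b ^ r ≤ Real.exp (-(x / 2) * r) := by
  have h1 : √b ≤ Real.exp ((c - x) / 2) := by
    rw [Real.sqrt_le_left (Real.exp_pos _).le, ← Real.exp_nat_mul]
    convert h using 2
    push_cast; ring
  calc _ ≤ Real.exp (-(c / 2) * r) * Real.exp ((c - x) / 2) ^ r := by gcongr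
    _ = _ := by
      rw [← Real.exp_nat_mul, ← Real.exp_add]
      congr 1; ring

lemma chiSquared_upper_tail {η : ℝ} (h0 : 0 ≤ η) (h1 : η ≤ 1) (r : ℕ) :
    (stdGaussianPi (Fin r)).real {z | (1 + η) * r ≤ ∑ i, z i ^ 2}
      ≤ Real.exp (-η ^ 2 * r / 8) := by
  have hp : 0 < 1 + η := by linarith
  have ht : η / (2 * (1 + η)) < 1 / 2 := by
    rw [div_lt_div_iff₀ (by positivity) (by norm_num)]; linarith
  refine (measure_ge_le_exp_mul_mgf _ (t := η / (2 * (1 + η))) (by positivity)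
    (integrable_exp_mul_sum_sq_stdGaussianPi _ ht)).trans ?_
  rw [mgf_sum_sq_stdGaussianPi, Fintype.card_fin]
  have e1 : -(η / (2 * (1 + η))) * ((1 + η) * r) = -(η / 2) * r := by
    field_simp
  have e2 : (1 - 2 * (η / (2 * (1 + η))))⁻¹ = 1 + η := by
    rw [inv_eq_iff_eq_inv]
    field_simp
    ring
  rw [e1, e2]
  exact (sqrt_pow_mul_exp_le r (one_add_le_exp_sub_sq h0 h1)).trans_eq (congrArg _ (by ring))

lemma chiSquared_lower_tail {η : ℝ} (h0 : 0 ≤ η) (h1 : η < 1) (r : ℕ) :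
    (stdGaussianPi (Fin r)).real {z | ∑ i, z i ^ 2 ≤ (1 - η) * r}
      ≤ Real.exp (-η ^ 2 * r / 8) := by
  have hp : 0 < 1 - η := by linarith
  have hn : -η / (2 * (1 - η)) ≤ 0 := div_nonpos_of_nonpos_of_nonneg (by linarith) (by linarith)
  refine (measure_le_le_exp_mul_mgf _ (t := -η / (2 * (1 - η))) hn
    (integrable_exp_mul_sum_sq_stdGaussianPi _ (by linarith))).trans ?_
  rw [mgf_sum_sq_stdGaussianPi, Fintype.card_fin]
  have e1 : -(-η / (2 * (1 - η))) * ((1 - η) * r) = -(-η / 2) * r := by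
    field_simp
  have e2 : (1 - 2 * (-η / (2 * (1 - η))))⁻¹ = 1 - η := by
    rw [inv_eq_iff_eq_inv]
    field_simp
    ring
  rw [e1, e2]
  exact (sqrt_pow_mul_exp_le r (one_sub_le_exp_neg_sub_sq h0 h1)).trans_eq (congrArg _ (by ring))

lemma measurableSet_setOf_sum_sq_mem_Icc {ι : Type*} [Fintype ι] (a b : ℝ) :
    MeasurableSet {z : ι → ℝ | ∑ i, z i ^ 2 ∈ Set.Icc a b} :=
  (by fun_prop : Measurable fun z : ι → ℝ => ∑ i, z i ^ 2) measurableSet_Icc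

/-- Two-sided concentration of the chi-squared distribution with `r` degrees of freedom. -/
lemma chiSquared_concentration {η : ℝ} (h0 : 0 ≤ η) (h1 : η < 1) (r : ℕ) :
    ENNReal.ofReal (1 - 2 * Real.exp (-η ^ 2 * r / 8)) ≤
      stdGaussianPi (Fin r) {z | ∑ i, z i ^ 2 ∈ Set.Icc ((1 - η) * r) ((1 + η) * r)} := by
  set A : Set (Fin r → ℝ) := {z | ∑ i, z i ^ 2 ∈ Set.Icc ((1 - η) * r) ((1 + η) * r)}
  have hA : MeasurableSet A := measurableSet_setOf_sum_sq_mem_Icc _ _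
  have hsub : Aᶜ ⊆ {z | (1 + η) * r ≤ ∑ i, z i ^ 2} ∪ {z | ∑ i, z i ^ 2 ≤ (1 - η) * r} := by
    intro z hz
    simp only [A, Set.mem_compl_iff, Set.mem_ofPred_eq, Set.mem_Icc, not_and_or, not_le] at hz
    exact hz.symm.imp le_of_lt le_of_lt
  have hle : (stdGaussianPi (Fin r)).real Aᶜ ≤ 2 * Real.exp (-η ^ 2 * r / 8) := by
    refine (measureReal_mono hsub).trans ((measureReal_union_le _ _).trans ?_)
    linarith [chiSquared_upper_tail h0 h1.le r, chiSquared_lower_tail h0 h1 r]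
  rw [probReal_compl_eq_one_sub hA] at hle
  rw [← ofReal_measureReal]
  exact ENNReal.ofReal_le_ofReal (by linarith)

/-- A standard Gaussian matrix applied to a unit vector is a standard Gaussian vector. -/
lemma measurePreserving_mulVec {m ι : Type*} [Fintype m] [Fintype ι] {a : ι → ℝ}
    (ha : a ⬝ᵥ a = 1) :
    MeasurePreserving (fun M : Matrix m ι ℝ => M *ᵥ a) (stdGaussianMatrix m ι)
      (stdGaussianPi m) :=
  measurePreserving_pi (fun _ : m => stdGaussianPi ι) (fun _ => gaussianReal 0 1)
    (fun _ => measurePreserving_dotProduct ha)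

lemma edgeMatrix_mulVec_indicator {n : ℕ} (ω : Fin n → Fin n → ℝ) (S : Finset (Fin n))
    (p : Pairs n) :
    (edgeMatrix ω *ᵥ fun v => if v ∈ S then 1 else 0) p = √(ω p.1.1 p.1.2) *
      ((if p.1.1 ∈ S then 1 else 0) - if p.1.2 ∈ S then 1 else 0) := by
  have hne : p.1.2 ≠ p.1.1 := p.2.ne'
  have h : ∀ x : Fin n, (if x = p.1.1 then (1 : ℝ) else if x = p.1.2 then -1 else 0)
      = (if x = p.1.1 then 1 else 0) - if x = p.1.2 then 1 else 0 := by
    intro x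
    by_cases h1 : x = p.1.1
    · simp [h1, hne.symm]
    · simp only [h1, if_false]; split_ifs <;> simp
  simp only [mulVec, dotProduct, edgeMatrix, of_apply, h, mul_assoc, ← Finset.mul_sum, sub_mul,
    Finset.sum_sub_distrib, ite_mul, one_mul, zero_mul, Finset.sum_ite_eq',
    Finset.mem_univ, if_true]

/-- The Laplacian quadratic form at an indicator vector is the cut value. -/
lemma edgeMatrix_mulVec_indicator_dotProduct_self {n : ℕ} {ω : Fin n → Fin n → ℝ}
    (hsymm : ∀ u v, ω u v = ω v u) (hnn : ∀ u v, 0 ≤ ω u v) (S : Finset (Fin n)) :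
    (edgeMatrix ω *ᵥ fun v => if v ∈ S then 1 else 0) ⬝ᵥ
      (edgeMatrix ω *ᵥ fun v => if v ∈ S then 1 else 0) = ∑ u ∈ S, ∑ v ∈ Sᶜ, ω u v := by
  set g : Fin n → Fin n → ℝ := fun u v => if u ∈ S ∧ v ∉ S then ω u v else 0 with hg
  have hpair : ∀ p : Pairs n,
      (edgeMatrix ω *ᵥ fun v => if v ∈ S then 1 else 0) p *
        (edgeMatrix ω *ᵥ fun v => if v ∈ S then 1 else 0) p
        = g p.1.1 p.1.2 + g p.1.2 p.1.1 := by
    intro p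
    rw [edgeMatrix_mulVec_indicator, mul_mul_mul_comm, Real.mul_self_sqrt (hnn _ _)]
    by_cases h1 : p.1.1 ∈ S <;> by_cases h2 : p.1.2 ∈ S <;> simp [hg, h1, h2, hsymm p.1.2 p.1.1]
  have hcut : ∑ u ∈ S, ∑ v ∈ Sᶜ, ω u v = ∑ u, ∑ v, g u v := by
    simp only [hg, ite_and, ← Finset.mem_compl, Finset.sum_ite_irrel, Finset.sum_const_zero,
      Finset.sum_ite_mem, Finset.univ_inter]
  have hsub : ∑ p : Pairs n, (g p.1.1 p.1.2 + g p.1.2 p.1.1)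
      = ∑ u, ∑ v, if u < v then g u v + g v u else 0 := by
    rw [← Fintype.sum_prod_type' (f := fun u v => if u < v then g u v + g v u else 0),
      ← Finset.sum_filter]
    exact (Finset.sum_subtype _ (by simp) fun q : Fin n × Fin n => g q.1 q.2 + g q.2 q.1).symm
  have hsplit : ∀ u v, (if u < v then g u v + g v u else 0)
      = (if u < v then g u v else 0) + if u < v then g v u else 0 := by
    intro u v; split_ifs <;> simp
  rw [dotProduct, Finset.sum_congr rfl fun p _ => hpair p, hsub, hcut]
  simp only [hsplit, Finset.sum_add_distrib]
  rw [Finset.sum_comm (f := fun u v => if u < v then g v u else 0), ← Finset.sum_add_distrib]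
  refine Finset.sum_congr rfl fun u _ => ?_
  rw [← Finset.sum_add_distrib]
  refine Finset.sum_congr rfl fun v _ => ?_
  rcases lt_trichotomy u v with h | h | h
  · simp [h, h.not_gt]
  · subst h; simp [hg]
  · simp [h, h.not_gt]

lemma sum_cut_modWeights {n : ℕ} (w : ℝ) (ω : Fin n → Fin n → ℝ) (S : Finset (Fin n)) :
    ∑ u ∈ S, ∑ v ∈ Sᶜ, modWeights w ω u v
      = w * S.card * ((n : ℝ) - S.card) / n + (1 - w / n) * ∑ u ∈ S, ∑ v ∈ Sᶜ, ω u v := by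
  have h : ∀ u ∈ S, ∀ v ∈ Sᶜ, modWeights w ω u v = w / n + (1 - w / n) * ω u v := by
    intro u hu v hv
    have : u ≠ v := fun h => Finset.mem_compl.1 hv (h ▸ hu)
    simp [modWeights, this]
  rw [Finset.sum_congr rfl fun u hu => Finset.sum_congr rfl (h u hu)]
  have hc : S.card ≤ n := by simpa using S.card_le_univ
  simp only [Finset.sum_add_distrib, Finset.sum_const, ← Finset.mul_sum, Finset.card_compl,
    Fintype.card_fin, nsmul_eq_mul, Nat.cast_sub hc]
  ring

lemma dotProduct_sketch_mulVec {m p q : Type*} [Fintype m] [Fintype p] [Fintype q] (c : ℝ)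
    (E : Matrix p q ℝ) (M : Matrix m p ℝ) (x : q → ℝ) :
    x ⬝ᵥ ((c • (Eᵀ * Mᵀ * M * E)) *ᵥ x) = c * ((M *ᵥ (E *ᵥ x)) ⬝ᵥ (M *ᵥ (E *ᵥ x))) := by
  rw [smul_mulVec, dotProduct_smul, smul_eq_mul, ← transpose_mul, Matrix.mul_assoc,
    ← mulVec_mulVec, dotProduct_mulVec, vecMul_transpose, mulVec_mulVec]

/-- Theorem 3.2: utility of the JL algorithm for cut queries. -/
theorem jl_cut_utility {n : ℕ} (hn : 2 ≤ n) {ω : Fin n → Fin n → ℝ}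
    (hω : IsWeightedGraph ω) {w η : ℝ} (hw : 0 < w) (hwn : w ≤ n / 2)
    (hη : 0 < η) (hη2 : η < 1 / 2) {r : ℕ} (hr : 0 < r)
    (S : Finset (Fin n)) (hS : S.Nonempty) (hS' : S ≠ Finset.univ) :
    stdGaussianMatrix (Fin r) (Pairs n)
      {M : Matrix (Fin r) (Pairs n) ℝ |
        let ind : Fin n → ℝ := fun v => if v ∈ S then 1 else 0
        let Lt : Matrix (Fin n) (Fin n) ℝ :=
          ((r : ℝ)⁻¹) • ((edgeMatrix (modWeights w ω))ᵀ * Mᵀ * M * edgeMatrix (modWeights w ω))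
        let R : ℝ := (1 - w / n)⁻¹ *
          (ind ⬝ᵥ (Lt *ᵥ ind) - w * S.card * ((n : ℝ) - S.card) / n)
        let Φ : ℝ := ∑ u ∈ S, ∑ v ∈ Sᶜ, ω u v
        (1 - η) * Φ - 2 * η * w * S.card ≤ R ∧ R ≤ (1 + η) * Φ + 2 * η * w * S.card}
    ≥ ENNReal.ofReal (1 - 2 * Real.exp (-η ^ 2 * r / 8)) := by

  set Φ : ℝ := ∑ u ∈ S, ∑ v ∈ Sᶜ, ω u v with hΦ
  obtain ⟨hsymm, -, hbd⟩ := hω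
  have hn0 : (0 : ℝ) < n := by exact_mod_cast (by omega : 0 < n)
  have hr0 : (0 : ℝ) < r := by exact_mod_cast hr
  have hs0 : (0 : ℝ) < S.card := by exact_mod_cast hS.card_pos
  have hsn : (0 : ℝ) < (n : ℝ) - S.card := by
    have : S.card < n := by simpa using (Finset.card_lt_iff_ne_univ S).2 hS'
    have : (S.card : ℝ) < n := by exact_mod_cast this
    linarith
  have hq : 1 / 2 ≤ 1 - w / n := by
    have : w / n ≤ 1 / 2 := by rw [div_le_iff₀ hn0]; linarith
    linarith
  have hq0 : 0 < 1 - w / n := by linarith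
  have hΦ0 : 0 ≤ Φ := Finset.sum_nonneg fun u _ => Finset.sum_nonneg fun v _ => (hbd u v).1
  set x : Pairs n → ℝ := edgeMatrix (modWeights w ω) *ᵥ fun v => if v ∈ S then 1 else 0 with hx
  set b : ℝ := w * S.card * ((n : ℝ) - S.card) / n with hb
  have hb0 : 0 < b := by positivity
  have hb1 : b ≤ w * S.card := by
    rw [hb, div_le_iff₀ hn0]
    exact mul_le_mul_of_nonneg_left (by linarith) (by positivity)
  have hxx : x ⬝ᵥ x = b + (1 - w / n) * Φ := by
    rw [hx, edgeMatrix_mulVec_indicator_dotProduct_self, sum_cut_modWeights]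
    · intro u v
      by_cases h : u = v
      · rw [h]
      · simp [modWeights, h, Ne.symm h, hsymm u v]
    · intro u v
      have := (hbd u v).1
      unfold modWeights
      split_ifs <;> positivity
  set c : ℝ := b + (1 - w / n) * Φ with hc
  have hc0 : 0 < c := by positivity
  set a : Pairs n → ℝ := (√c)⁻¹ • x with ha
  have hsc : √c * √c = c := Real.mul_self_sqrt hc0.le
  have hscp : 0 < √c := Real.sqrt_pos.2 hc0
  have haa : a ⬝ᵥ a = 1 := by
    rw [ha, smul_dotProduct, dotProduct_smul, hxx, smul_eq_mul, smul_eq_mul, ← mul_assoc,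
      ← mul_inv, hsc, inv_mul_cancel₀ hc0.ne']
  have hxa : x = √c • a := by rw [ha, smul_smul, mul_inv_cancel₀ hscp.ne', one_smul]
  have hmp := measurePreserving_mulVec (m := Fin r) haa
  refine (chiSquared_concentration hη.le (by linarith) r).trans ?_
  rw [← hmp.measure_preimage
    (measurableSet_setOf_sum_sq_mem_Icc _ _).nullMeasurableSet]
  refine measure_mono fun M hM => ?_
  obtain ⟨h1, h2⟩ := hM
  set T : ℝ := ∑ i, (M *ᵥ a) i ^ 2 with hT
  have hquad : (M *ᵥ x) ⬝ᵥ (M *ᵥ x) = c * T := by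
    rw [hxa, mulVec_smul, smul_dotProduct, dotProduct_smul, smul_eq_mul, smul_eq_mul, ← mul_assoc,
      hsc, hT]
    simp only [dotProduct, pow_two]
  simp only [Set.mem_ofPred_eq]
  rw [dotProduct_sketch_mulVec, ← hx, hquad]
  have hy1 : (1 - η) * c ≤ (r : ℝ)⁻¹ * (c * T) := by
    rw [inv_mul_eq_div, le_div_iff₀ hr0]; nlinarith
  have hy2 : (r : ℝ)⁻¹ * (c * T) ≤ (1 + η) * c := by
    rw [inv_mul_eq_div, div_le_iff₀ hr0]; nlinarith
  have hbw : η * b ≤ 2 * η * w * S.card * (1 - w / n) := by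
    have h3 : η * b ≤ η * (w * S.card) := mul_le_mul_of_nonneg_left hb1 hη.le
    have h4 : 0 ≤ η * (w * S.card) := mul_nonneg hη.le (mul_nonneg hw.le hs0.le)
    nlinarith
  rw [inv_mul_eq_div, le_div_iff₀ hq0, div_le_iff₀ hq0]
  constructor <;> nlinarith
end
end

section
/- Privacy of the covariance-matrix algorithm (Theorem 4.1): Let n, d be positive integers, ε, δ ∈ (0,1), let r be a positive integer, and set w = (16·√(r·ln(2/δ))/ε)·ln(16r/δ). For an n×d real matrix A let Ā = A − (1/n)·J·A where J is the all-ones n×n matrix (mean-centering), and let B_A = (ĀᵀĀ + w²·I_d)^{1/2}. Let μ_A be the pushforward of the standard Gaussian measure γ_{r×d} on r×d real matrices under the map M ↦ (1/r)·B_Aᵀ Mᵀ M B_A. Then for any two neighboring n×d matrices A, A′ and every measurable set S of d×d real matrices, μ_A(S) ≤ e^ε · μ_{A′}(S) + δ. -/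
open MeasureTheory ProbabilityTheory Matrix

noncomputable section

/-- Two `n×d` matrices are neighbors if they differ on a single row,
whose change has `ℓ₂`-norm at most 1. -/
def MatNeighbors {n d : ℕ} (A A' : Matrix (Fin n) (Fin d) ℝ) : Prop :=
  ∃ (i : Fin n) (v : Fin d → ℝ), Real.sqrt (∑ j, v j ^ 2) ≤ 1 ∧
    A' = A + Matrix.of fun k j => if k = i then v j else 0

/-- Mean-centering of the rows of `A`:  `A - (1/n)·J·A` with `J` the all-ones matrix. -/
def centerMat {n d : ℕ} (A : Matrix (Fin n) (Fin d) ℝ) : Matrix (Fin n) (Fin d) ℝ :=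
  A - ((n : ℝ)⁻¹) • ((Matrix.of fun _ _ : Fin n => (1 : ℝ)) * A)

open scoped ENNReal

/-- The integral of a product of functions of the separate coordinates. -/
lemma lintegral_pi_prod {ι : Type*} [Fintype ι] {α : ι → Type*} [∀ i, MeasurableSpace (α i)]
    (μ : ∀ i, Measure (α i)) [∀ i, IsProbabilityMeasure (μ i)] {f : ∀ i, α i → ℝ≥0∞}
    (hf : ∀ i, Measurable (f i)) :
    ∫⁻ x, ∏ i, f i (x i) ∂Measure.pi μ = ∏ i, ∫⁻ y, f i y ∂μ i := by
  rw [lintegral_prod_eq_prod_lintegral_of_indepFun Finset.univ (fun i (x : ∀ i, α i) => f i (x i))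
    (iIndepFun_pi fun i => (hf i).aemeasurable) fun i => (hf i).comp (measurable_pi_apply i)]
  refine Finset.prod_congr rfl fun i _ => ?_
  exact (measurePreserving_eval μ i).lintegral_comp (hf i)

lemma pi_withDensity_eq {ι : Type*} [Fintype ι] {α : ι → Type*} [∀ i, MeasurableSpace (α i)]
    (μ : ∀ i, Measure (α i)) [∀ i, IsProbabilityMeasure (μ i)] {f : ∀ i, α i → ℝ≥0∞}
    (hf : ∀ i, Measurable (f i)) [∀ i, SigmaFinite ((μ i).withDensity (f i))] :
    Measure.pi (fun i => (μ i).withDensity (f i)) =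
      (Measure.pi μ).withDensity fun x => ∏ i, f i (x i) := by
  refine Measure.pi_eq fun s hs => ?_
  rw [withDensity_apply _ (.univ_pi hs), ← lintegral_indicator (.univ_pi hs)]
  have h (x : ∀ i, α i) : (Set.univ.pi s).indicator (fun x => ∏ i, f i (x i)) x =
      ∏ i, (s i).indicator (f i) (x i) := by
    by_cases hx : x ∈ Set.univ.pi s
    · rw [Set.indicator_of_mem hx]
      exact Finset.prod_congr rfl fun i _ => (Set.indicator_of_mem (hx i trivial) _).symm
    · rw [Set.indicator_of_notMem hx]
      simp only [Set.mem_pi, Set.mem_univ, true_imp_iff, not_forall] at hx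
      obtain ⟨i, hi⟩ := hx
      exact (Finset.prod_eq_zero (Finset.mem_univ i) (Set.indicator_of_notMem hi _)).symm
  simp_rw [h]
  rw [lintegral_pi_prod μ fun i => (hf i).indicator (hs i)]
  refine Finset.prod_congr rfl fun i _ => ?_
  rw [lintegral_indicator (hs i), withDensity_apply _ (hs i)]

/-- A bound on a power moment of the density gives approximate domination of measures. -/
lemma withDensity_le_add_lintegral_rpow {α : Type*} [MeasurableSpace α] (μ : Measure α)
    {f : α → ℝ≥0∞} (hf : Measurable f) {c : ℝ≥0∞} (hc : c ≠ 0) (hc' : c ≠ ∞) {t : ℝ} (ht : 0 ≤ t)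
    {S : Set α} (hS : MeasurableSet S) :
    μ.withDensity f S ≤ c * μ S + c ^ (-t) * ∫⁻ x, f x ^ (1 + t) ∂μ := by
  have key (x : α) : f x ≤ c + c ^ (-t) * f x ^ (1 + t) := by
    rcases le_total (f x) c with h | h
    · exact h.trans le_self_add
    · refine le_trans ?_ le_add_self
      calc f x = c ^ (-t) * (c ^ t * f x) := by
            rw [← mul_assoc, ← ENNReal.rpow_add _ _ hc hc']; simp
        _ ≤ c ^ (-t) * (f x ^ t * f x) := by gcongr
        _ = c ^ (-t) * f x ^ (1 + t) := by
            rw [add_comm 1 t, ENNReal.rpow_add_of_nonneg _ _ ht zero_le_one, ENNReal.rpow_one]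
  rw [withDensity_apply _ hS]
  calc ∫⁻ x in S, f x ∂μ ≤ ∫⁻ x in S, (c + c ^ (-t) * f x ^ (1 + t)) ∂μ :=
        lintegral_mono key
    _ = c * μ S + c ^ (-t) * ∫⁻ x in S, f x ^ (1 + t) ∂μ := by
        rw [lintegral_add_left measurable_const, setLIntegral_const,
          lintegral_const_mul _ (hf.pow_const _)]
    _ ≤ _ := by gcongr; exact Measure.restrict_le_self

lemma sub_two_mul_sq_le_log_one_add {y : ℝ} (hy : -(1 / 2) ≤ y) :
    y - 2 * y ^ 2 ≤ Real.log (1 + y) := by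
  have h : 0 < 1 + y := by linarith
  refine le_trans ?_ (Real.one_sub_inv_le_log_of_pos h)
  have : 1 - (1 + y)⁻¹ = y / (1 + y) := by field_simp; ring
  rw [this, le_div_iff₀ h]
  nlinarith [mul_nonneg (sq_nonneg y) (by linarith : 0 ≤ 1 + 2 * y)]

/-- The density of `N(0, 1 + s)` with respect to `N(0, 1)`. -/
def gaussianRatio (s x : ℝ) : ℝ :=
  (√(1 + s))⁻¹ * Real.exp (-((1 + s)⁻¹ - 1) * x ^ 2 / 2)

lemma measurable_gaussianRatio (s : ℝ) :
    Measurable fun x => ENNReal.ofReal (gaussianRatio s x) := by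
  unfold gaussianRatio; fun_prop

lemma gaussianReal_map_mul_sqrt {s : ℝ} (hs : 0 < 1 + s) :
    (gaussianReal 0 1).map (· * √(1 + s)) =
      (gaussianReal 0 1).withDensity fun x => ENNReal.ofReal (gaussianRatio s x) := by
  rw [gaussianReal_map_mul_const, gaussianReal_of_var_ne_zero, gaussianReal_of_var_ne_zero _
    one_ne_zero, ← withDensity_mul _ (measurable_gaussianPDF _ _) (measurable_gaussianRatio s)]
  · congr 1
    ext x
    simp only [gaussianPDF, Pi.mul_apply, gaussianPDFReal, gaussianRatio]
    rw [← ENNReal.ofReal_mul (by positivity)]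
    congr 1
    have h : Real.sqrt (1 + s) ^ 2 = 1 + s := Real.sq_sqrt hs.le
    simp only [mul_zero, sub_zero, NNReal.coe_mk, h, NNReal.coe_one, mul_one]
    rw [Real.sqrt_mul (by positivity), mul_inv, mul_mul_mul_comm, ← Real.exp_add]
    congr 2
    field_simp
    ring
  · rw [Ne, ← NNReal.coe_inj]
    simpa using (Real.sqrt_pos.2 hs).ne'

lemma lintegral_gaussianRatio_rpow_le {s t : ℝ} (ht : 0 ≤ t) (hs : -(1 / 2) ≤ s)
    (hts : t * s ≤ 1 / 2) :
    ∫⁻ x, ENNReal.ofReal (gaussianRatio s x) ^ (1 + t) ∂gaussianReal 0 1 ≤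
      ENNReal.ofReal (Real.exp ((t + t ^ 2) * s ^ 2)) := by
  have h1 : 0 < 1 + s := by linarith
  have h2 : 0 < 1 - t * s := by linarith
  set b : ℝ := (1 - t * s) / (1 + s) / 2 with hb
  have hb0 : 0 < b := by positivity
  rw [gaussianReal_of_var_ne_zero _ one_ne_zero, lintegral_withDensity_eq_lintegral_mul _
    (measurable_gaussianPDF _ _) ((measurable_gaussianRatio s).pow_const _)]
  have h (x : ℝ) : (gaussianPDF 0 1 * fun x => ENNReal.ofReal (gaussianRatio s x) ^ (1 + t)) x =
      ENNReal.ofReal (Real.exp (-((1 + t) / 2 * Real.log (1 + s))) * (√(2 * Real.pi))⁻¹ *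
        Real.exp (-b * x ^ 2)) := by
    have hg : 0 < gaussianRatio s x := by unfold gaussianRatio; positivity
    have hl : Real.log (gaussianRatio s x) =
        -(Real.log (1 + s) / 2) + -((1 + s)⁻¹ - 1) * x ^ 2 / 2 := by
      rw [gaussianRatio, Real.log_mul (by positivity) (Real.exp_pos _).ne', Real.log_exp,
        Real.log_inv, Real.log_sqrt h1.le]
    rw [Pi.mul_apply, ENNReal.ofReal_rpow_of_pos hg, Real.rpow_def_of_pos hg, hl, gaussianPDF,
      ← ENNReal.ofReal_mul (gaussianPDFReal_nonneg _ _ _), gaussianPDFReal]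
    congr 1
    rw [mul_comm (Real.exp _) (√(2 * Real.pi))⁻¹]
    simp only [NNReal.coe_one, mul_one, sub_zero]
    rw [mul_assoc, mul_assoc, ← Real.exp_add, ← Real.exp_add]
    congr 2
    rw [hb]
    field_simp
    ring
  simp_rw [h]
  rw [← ofReal_integral_eq_lintegral_ofReal ((integrable_exp_neg_mul_sq hb0).const_mul _)
    (Filter.Eventually.of_forall fun x => by positivity), integral_const_mul, integral_gaussian]
  refine ENNReal.ofReal_le_ofReal ?_
  have h3 : (√(2 * Real.pi))⁻¹ * √(Real.pi / b) =
      Real.exp (-(Real.log (1 - t * s) / 2) + Real.log (1 + s) / 2) := by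
    rw [← Real.sqrt_inv, ← Real.sqrt_mul (by positivity)]
    have : (2 * Real.pi)⁻¹ * (Real.pi / b) = (1 + s) / (1 - t * s) := by
      rw [hb]; field_simp
    rw [this, ← Real.exp_log (Real.sqrt_pos.2 (div_pos h1 h2)), Real.log_sqrt (by positivity),
      Real.log_div h1.ne' h2.ne']
    congr 1
    ring
  rw [mul_assoc, h3, ← Real.exp_add]
  refine Real.exp_le_exp.2 ?_
  have e1 := sub_two_mul_sq_le_log_one_add hs
  have e2 := sub_two_mul_sq_le_log_one_add (y := -(t * s)) (by linarith)
  rw [← sub_eq_add_neg] at e2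
  nlinarith [mul_le_mul_of_nonneg_left e1 ht]

lemma stdGaussianPi_map_mul_sqrt {ι : Type*} [Fintype ι] {s : ι → ℝ} (hs : ∀ j, 0 < 1 + s j) :
    (stdGaussianPi ι).map (fun x j => x j * √(1 + s j)) =
      (stdGaussianPi ι).withDensity fun x => ∏ j, ENNReal.ofReal (gaussianRatio (s j) (x j)) := by
  have h (j : ι) : IsProbabilityMeasure ((gaussianReal 0 1).withDensity
      fun x => ENNReal.ofReal (gaussianRatio (s j) x)) := by
    rw [← gaussianReal_map_mul_sqrt (hs j)]
    exact Measure.isProbabilityMeasure_map (by fun_prop)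
  unfold stdGaussianPi
  rw [Measure.pi_map_pi (f := fun j y => y * √(1 + s j)) fun j => by fun_prop,
    ← pi_withDensity_eq _ fun j => measurable_gaussianRatio (s j)]
  simp_rw [gaussianReal_map_mul_sqrt (hs _)]

lemma lintegral_prod_gaussianRatio_rpow_le {ι : Type*} [Fintype ι] {s : ι → ℝ} {t : ℝ}
    (ht : 0 ≤ t) (hs : ∀ j, -(1 / 2) ≤ s j) (hts : ∀ j, t * s j ≤ 1 / 2) :
    ∫⁻ x, (∏ j, ENNReal.ofReal (gaussianRatio (s j) (x j))) ^ (1 + t) ∂stdGaussianPi ι ≤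
      ENNReal.ofReal (Real.exp ((t + t ^ 2) * ∑ j, s j ^ 2)) := by
  simp_rw [← ENNReal.prod_rpow_of_nonneg (by linarith : 0 ≤ 1 + t)]
  unfold stdGaussianPi
  rw [lintegral_pi_prod _ fun j => (measurable_gaussianRatio (s j)).pow_const (1 + t),
    Finset.mul_sum, Real.exp_sum, ENNReal.ofReal_prod_of_nonneg fun _ _ => (Real.exp_pos _).le]
  exact Finset.prod_le_prod' fun j _ => lintegral_gaussianRatio_rpow_le ht (hs j) (hts j)

/-- Rescaling the columns of a standard Gaussian matrix by factors close to `1` yields a law that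
is approximately dominated by the original one. -/
lemma stdGaussianMatrix_map_mul_sqrt_le {m ι : Type*} [Fintype m] [Fintype ι] {s : ι → ℝ} {t : ℝ}
    (ε : ℝ) (ht : 0 ≤ t) (hs : ∀ j, -(1 / 2) ≤ s j) (hts : ∀ j, t * s j ≤ 1 / 2)
    {S : Set (Matrix m ι ℝ)} (hS : MeasurableSet S) :
    (stdGaussianMatrix m ι).map
        (fun M => (fun k j => M k j * √(1 + s j) : Matrix m ι ℝ)) S ≤
      ENNReal.ofReal (Real.exp ε) * stdGaussianMatrix m ι S +
        ENNReal.ofReal (Real.exp (-t * ε + Fintype.card m * ((t + t ^ 2) * ∑ j, s j ^ 2))) := by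
  have hs' (j : ι) : 0 < 1 + s j := by linarith [hs j]
  have hf : Measurable fun x : ι → ℝ => ∏ j, ENNReal.ofReal (gaussianRatio (s j) (x j)) :=
    Finset.measurable_prod _ fun j _ =>
      (measurable_gaussianRatio (s j)).comp (measurable_pi_apply j)
  have hg : Measurable fun (x : ι → ℝ) j => x j * √(1 + s j) := by fun_prop
  have h : IsProbabilityMeasure ((stdGaussianPi ι).withDensity
      fun x => ∏ j, ENNReal.ofReal (gaussianRatio (s j) (x j))) := by
    rw [← stdGaussianPi_map_mul_sqrt hs']
    exact Measure.isProbabilityMeasure_map hg.aemeasurable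
  have hmap : (stdGaussianMatrix m ι).map
      (fun M => (fun k j => M k j * √(1 + s j) : Matrix m ι ℝ)) =
      (stdGaussianMatrix m ι).withDensity
        fun M => ∏ k, ∏ j, ENNReal.ofReal (gaussianRatio (s j) (M k j)) := by
    have h0 : (Measure.pi fun _ : m => stdGaussianPi ι).map
        (fun M => (fun k j => M k j * √(1 + s j))) =
      (Measure.pi fun _ : m => stdGaussianPi ι).withDensity
        fun M => ∏ k, ∏ j, ENNReal.ofReal (gaussianRatio (s j) (M k j)) := by
      have : IsProbabilityMeasure ((stdGaussianPi ι).map fun x j => x j * √(1 + s j)) :=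
        Measure.isProbabilityMeasure_map hg.aemeasurable
      rw [Measure.pi_map_pi (f := fun _ (x : ι → ℝ) j => x j * √(1 + s j))
          fun _ => hg.aemeasurable,
        ← pi_withDensity_eq _ fun _ => hf]
      simp_rw [stdGaussianPi_map_mul_sqrt hs']
    exact h0
  have hF : Measurable
      fun M : Matrix m ι ℝ => ∏ k, ∏ j, ENNReal.ofReal (gaussianRatio (s j) (M k j)) :=
    Finset.measurable_prod _ fun k _ => hf.comp (measurable_pi_apply k)
  rw [hmap]
  refine (withDensity_le_add_lintegral_rpow _ hF (c := ENNReal.ofReal (Real.exp ε))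
    (by simp [Real.exp_pos]) ENNReal.ofReal_ne_top ht hS).trans ?_
  gcongr
  rw [ENNReal.ofReal_rpow_of_pos (Real.exp_pos _), ← Real.exp_mul, mul_comm ε, Real.exp_add,
    ENNReal.ofReal_mul (Real.exp_pos _).le]
  gcongr
  have h1t : 0 ≤ 1 + t := by linarith
  conv_lhs => enter [2, M]; rw [← ENNReal.prod_rpow_of_nonneg h1t]
  calc ∫⁻ M, ∏ k, (∏ j, ENNReal.ofReal (gaussianRatio (s j) (M k j))) ^ (1 + t)
        ∂stdGaussianMatrix m ι
      = ∏ _k : m, ∫⁻ x, (∏ j, ENNReal.ofReal (gaussianRatio (s j) (x j))) ^ (1 + t)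
          ∂stdGaussianPi ι :=
        lintegral_pi_prod (fun _ : m => stdGaussianPi ι) fun _ => hf.pow_const (1 + t)
    _ ≤ ∏ _k : m, ENNReal.ofReal (Real.exp ((t + t ^ 2) * ∑ j, s j ^ 2)) :=
        Finset.prod_le_prod' fun _ _ => lintegral_prod_gaussianRatio_rpow_le ht hs hts
    _ = ENNReal.ofReal (Real.exp (Fintype.card m * ((t + t ^ 2) * ∑ j, s j ^ 2))) := by
        rw [Finset.prod_const, Finset.card_univ, Real.exp_nat_mul,
          ENNReal.ofReal_pow (Real.exp_pos _).le]

lemma measurable_matrix_mul_const {m ι : Type*} [Fintype ι] {κ : Type*} (V : Matrix ι κ ℝ) :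
    Measurable fun M : Matrix m ι ℝ => M * V := by
  refine measurable_pi_lambda _ fun k => measurable_pi_lambda _ fun j => ?_
  simp only [Matrix.mul_apply]
  exact Finset.measurable_sum _ fun i _ =>
    ((measurable_pi_apply i).comp (measurable_pi_apply k)).mul_const _

lemma stdGaussianPi_map_vecMul {ι : Type*} [Fintype ι] [DecidableEq ι] {V : Matrix ι ι ℝ}
    (hV : V * Vᵀ = 1) : (stdGaussianPi ι).map (fun x => x ᵥ* V) = stdGaussianPi ι := by
  have hnorm (x : EuclideanSpace ℝ ι) :
      ‖WithLp.toLp 2 (WithLp.ofLp x ᵥ* V)‖ = ‖x‖ := by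
    have h : (WithLp.ofLp x ᵥ* V) ⬝ᵥ (WithLp.ofLp x ᵥ* V) = WithLp.ofLp x ⬝ᵥ WithLp.ofLp x := by
      rw [← Matrix.dotProduct_mulVec, ← Matrix.mulVec_transpose, Matrix.mulVec_mulVec, hV,
        Matrix.one_mulVec]
    rw [EuclideanSpace.norm_eq, EuclideanSpace.norm_eq]
    congr 1
    simpa [dotProduct, sq] using h
  let f : EuclideanSpace ℝ ι →ₗᵢ[ℝ] EuclideanSpace ℝ ι :=
    { toFun := fun x => WithLp.toLp 2 (WithLp.ofLp x ᵥ* V)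
      map_add' := fun x y => by simp [Matrix.add_vecMul]
      map_smul' := fun c x => by simp [Matrix.smul_vecMul]
      norm_map' := hnorm }
  have hf := stdGaussian_map (f.toLinearIsometryEquiv rfl)
  have hm : Measurable (WithLp.toLp 2 : (ι → ℝ) → EuclideanSpace ℝ ι) :=
    WithLp.measurable_toLp 2 _
  have hm' : Measurable (WithLp.ofLp : EuclideanSpace ℝ ι → (ι → ℝ)) :=
    WithLp.measurable_ofLp 2 _
  have h0 : stdGaussianPi ι = (stdGaussian (EuclideanSpace ℝ ι)).map WithLp.ofLp := by
    rw [← map_pi_eq_stdGaussian, Measure.map_map hm' hm]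
    exact Measure.map_id.symm
  have hx : Measurable fun x : ι → ℝ => x ᵥ* V := by
    unfold Matrix.vecMul dotProduct; fun_prop
  nth_rewrite 2 [h0]
  rw [← hf, h0, Measure.map_map hx hm', Measure.map_map hm' (by fun_prop)]
  rfl

lemma stdGaussianMatrix_map_mul {m ι : Type*} [Fintype m] [Fintype ι] [DecidableEq ι]
    {V : Matrix ι ι ℝ} (hV : V * Vᵀ = 1) :
    (stdGaussianMatrix m ι).map (fun M => M * V) = stdGaussianMatrix m ι := by
  have hx : Measurable fun x : ι → ℝ => x ᵥ* V := by
    unfold Matrix.vecMul dotProduct; fun_prop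
  have := stdGaussianPi_map_vecMul hV
  have h : (Measure.pi fun _ : m => stdGaussianPi ι).map (fun M k => M k ᵥ* V) =
      Measure.pi fun _ : m => stdGaussianPi ι := by
    have : SigmaFinite ((stdGaussianPi ι).map fun x => x ᵥ* V) := by rw [this]; infer_instance
    rw [Measure.pi_map_pi (f := fun _ x => x ᵥ* V) fun _ => hx.aemeasurable]
    simp_rw [stdGaussianPi_map_vecMul hV]
  exact h

lemma zero_le_dotProduct_self {ι : Type*} [Fintype ι] (x : ι → ℝ) : 0 ≤ x ⬝ᵥ x :=
  Finset.sum_nonneg fun i _ => mul_self_nonneg (x i)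

lemma dotProduct_sq_le {ι : Type*} [Fintype ι] (x y : ι → ℝ) :
    (x ⬝ᵥ y) ^ 2 ≤ (x ⬝ᵥ x) * (y ⬝ᵥ y) := by
  simpa [dotProduct, sq] using Finset.sum_mul_sq_le_sq_mul_sq Finset.univ x y

lemma mulVec_dotProduct_mulVec_self {κ ι : Type*} [Fintype κ] [Fintype ι] (Y : Matrix κ ι ℝ)
    (z : ι → ℝ) : (Y *ᵥ z) ⬝ᵥ (Y *ᵥ z) = z ⬝ᵥ ((Yᵀ * Y) *ᵥ z) := by
  rw [← Matrix.mulVec_mulVec, Matrix.dotProduct_mulVec z, Matrix.vecMul_transpose]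

section Whitening

variable {m ι : Type*} [Fintype m] [Fintype ι] [DecidableEq ι] {X : Matrix m ι ℝ}
  {B : Matrix ι ι ℝ} {w : ℝ}

lemma mulVec_dotProduct_mulVec_of_mul_self (hB : Bᵀ = B) (hB2 : B * B = Xᵀ * X + (w ^ 2) • 1)
    (z : ι → ℝ) : (B *ᵥ z) ⬝ᵥ (B *ᵥ z) = (X *ᵥ z) ⬝ᵥ (X *ᵥ z) + w ^ 2 * (z ⬝ᵥ z) := by
  rw [mulVec_dotProduct_mulVec_self, mulVec_dotProduct_mulVec_self, hB, hB2,
    Matrix.add_mulVec, dotProduct_add, Matrix.smul_mulVec, Matrix.one_mulVec, dotProduct_smul, smul_eq_mul]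

lemma isUnit_det_of_mul_self (hB : Bᵀ = B) (hw : 0 < w)
    (hB2 : B * B = Xᵀ * X + (w ^ 2) • 1) : IsUnit B.det := by
  rw [isUnit_iff_ne_zero]
  intro h
  obtain ⟨z, hz, hBz⟩ := Matrix.exists_mulVec_eq_zero_iff.2 h
  have h1 := mulVec_dotProduct_mulVec_of_mul_self hB hB2 z
  rw [hBz, dotProduct_zero] at h1
  have h2 : 0 < z ⬝ᵥ z := by simpa using Matrix.dotProduct_star_self_pos_iff.2 hz
  have h3 : 0 ≤ (X *ᵥ z) ⬝ᵥ (X *ᵥ z) := zero_le_dotProduct_self (X *ᵥ z)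
  have : 0 < w ^ 2 * (z ⬝ᵥ z) := by positivity
  linarith

lemma exists_mulVec_eq_and_dotProduct_eq (hB : Bᵀ = B) (hu : IsUnit B.det) (a : ι → ℝ) :
    ∃ z, B *ᵥ z = B⁻¹ *ᵥ a ∧ (B⁻¹ *ᵥ a) ⬝ᵥ (B⁻¹ *ᵥ a) = z ⬝ᵥ a := by
  have h (y : ι → ℝ) : B *ᵥ (B⁻¹ *ᵥ y) = y := by
    rw [Matrix.mulVec_mulVec, Matrix.mul_nonsing_inv _ hu, Matrix.one_mulVec]
  refine ⟨B⁻¹ *ᵥ (B⁻¹ *ᵥ a), h _, ?_⟩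
  calc (B⁻¹ *ᵥ a) ⬝ᵥ (B⁻¹ *ᵥ a) = (B *ᵥ (B⁻¹ *ᵥ (B⁻¹ *ᵥ a))) ⬝ᵥ (B⁻¹ *ᵥ a) := by
        rw [h (B⁻¹ *ᵥ a)]
    _ = (B⁻¹ *ᵥ (B⁻¹ *ᵥ a)) ⬝ᵥ (B *ᵥ (B⁻¹ *ᵥ a)) := by
      rw [Matrix.dotProduct_mulVec _ B, ← Matrix.mulVec_transpose B, hB]
    _ = (B⁻¹ *ᵥ (B⁻¹ *ᵥ a)) ⬝ᵥ a := by rw [h a]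

lemma inv_mulVec_transpose_mulVec_le (hB : Bᵀ = B) (hw : 0 < w)
    (hB2 : B * B = Xᵀ * X + (w ^ 2) • 1) {u : m → ℝ} (hu : u ⬝ᵥ u ≤ 1) :
    (B⁻¹ *ᵥ (Xᵀ *ᵥ u)) ⬝ᵥ (B⁻¹ *ᵥ (Xᵀ *ᵥ u)) ≤ 1 := by
  obtain ⟨z, hz, h⟩ := exists_mulVec_eq_and_dotProduct_eq hB (isUnit_det_of_mul_self hB hw hB2)
    (Xᵀ *ᵥ u)
  have h1 := mulVec_dotProduct_mulVec_of_mul_self hB hB2 z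
  rw [Matrix.dotProduct_mulVec z, Matrix.vecMul_transpose] at h
  rw [hz] at h1
  have h2 : 0 ≤ z ⬝ᵥ z := zero_le_dotProduct_self z
  have h3 : 0 ≤ (X *ᵥ z) ⬝ᵥ (X *ᵥ z) := zero_le_dotProduct_self (X *ᵥ z)
  have h4 := dotProduct_sq_le (X *ᵥ z) u
  rw [← h] at h4
  have h5 := mul_le_mul_of_nonneg_left hu h3
  have h6 : 0 ≤ w ^ 2 * (z ⬝ᵥ z) := by positivity
  by_contra! hlt
  nlinarith

lemma inv_mulVec_le (hB : Bᵀ = B) (hw : 0 < w)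
    (hB2 : B * B = Xᵀ * X + (w ^ 2) • 1) {v : ι → ℝ} (hv : v ⬝ᵥ v ≤ 1) :
    (B⁻¹ *ᵥ v) ⬝ᵥ (B⁻¹ *ᵥ v) ≤ (w ^ 2)⁻¹ := by
  obtain ⟨z, hz, h⟩ := exists_mulVec_eq_and_dotProduct_eq hB (isUnit_det_of_mul_self hB hw hB2) v
  have h1 := mulVec_dotProduct_mulVec_of_mul_self hB hB2 z
  rw [hz] at h1
  have h2 : 0 ≤ z ⬝ᵥ z := zero_le_dotProduct_self z
  have h3 : 0 ≤ (X *ᵥ z) ⬝ᵥ (X *ᵥ z) := zero_le_dotProduct_self (X *ᵥ z)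
  have h4 := dotProduct_sq_le z v
  rw [← h] at h4
  have h5 := mul_le_mul_of_nonneg_left hv h2
  have hw2 : 0 < w ^ 2 := by positivity
  set Q := (B⁻¹ *ᵥ v) ⬝ᵥ (B⁻¹ *ᵥ v)
  rw [← one_div, le_div_iff₀ hw2]
  by_contra! hlt
  have hQ : 0 < Q := by
    by_contra! hQ
    nlinarith
  have h6 : w ^ 2 * Q ^ 2 ≤ Q := by nlinarith
  nlinarith

end Whitening

lemma sum_sq_rank_two_le {ι : Type*} [Fintype ι] {p q : ι → ℝ} {s w : ℝ} (hw : 1 ≤ w)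
    (hp : p ⬝ᵥ p ≤ 1) (hq : q ⬝ᵥ q ≤ (w ^ 2)⁻¹) (hs : 0 ≤ s) (hs1 : s ≤ 1) :
    ∑ i, ∑ j, (s * (q i * q j) - (p i * q j + q i * p j)) ^ 2 ≤ 9 / w ^ 2 := by
  have hp0 : 0 ≤ p ⬝ᵥ p := zero_le_dotProduct_self p
  have hq0 : 0 ≤ q ⬝ᵥ q := zero_le_dotProduct_self q
  have hprod (x y : ι → ℝ) : ∑ i, ∑ j, (x i * y j) ^ 2 = (x ⬝ᵥ x) * (y ⬝ᵥ y) := by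
    simp only [dotProduct, Finset.sum_mul_sum]
    exact Finset.sum_congr rfl fun i _ => Finset.sum_congr rfl fun j _ => by ring
  have hinv : (w ^ 2)⁻¹ ≤ 1 := inv_le_one_of_one_le₀ (one_le_pow₀ hw)
  calc ∑ i, ∑ j, (s * (q i * q j) - (p i * q j + q i * p j)) ^ 2
      ≤ ∑ i, ∑ j, 3 * ((q i * q j) ^ 2 + ((p i * q j) ^ 2 + (q i * p j) ^ 2)) := by
        refine Finset.sum_le_sum fun i _ => Finset.sum_le_sum fun j _ => ?_
        have : (s * (q i * q j)) ^ 2 ≤ (q i * q j) ^ 2 := by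
          rw [mul_pow]
          exact mul_le_of_le_one_left (sq_nonneg _) (pow_le_one₀ hs hs1)
        nlinarith [sq_nonneg (s * (q i * q j) + p i * q j), sq_nonneg (p i * q j - q i * p j),
          sq_nonneg (s * (q i * q j) + q i * p j)]
    _ = 3 * ((q ⬝ᵥ q) * (q ⬝ᵥ q) + ((p ⬝ᵥ p) * (q ⬝ᵥ q) + (q ⬝ᵥ q) * (p ⬝ᵥ p))) := by
        simp only [← Finset.mul_sum, Finset.sum_add_distrib, hprod]
    _ ≤ 9 / w ^ 2 := by
        rw [div_eq_mul_inv]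
        nlinarith [mul_le_of_le_one_left hq0 hp, mul_le_of_le_one_left hq0 (hq.trans hinv)]

lemma sum_eigenvalues_sq {ι : Type*} [Fintype ι] [DecidableEq ι] {E : Matrix ι ι ℝ}
    (hE : E.IsHermitian) : ∑ j, hE.eigenvalues j ^ 2 = ∑ i, ∑ j, E i j ^ 2 := by
  have h1 : (E * E).trace = ∑ i, ∑ j, E i j ^ 2 := by
    have hT (i j : ι) : E j i = E i j := by simpa using hE.apply i j
    simp [Matrix.trace, Matrix.mul_apply, hT, sq]
  have h2 := hE.spectral_theorem
  rw [← h1]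
  conv_rhs => rw [h2]
  rw [← map_mul, Unitary.conjStarAlgAut_apply, Matrix.trace_mul_cycle,
    Unitary.coe_star_mul_self, Matrix.one_mul, Matrix.diagonal_mul_diagonal, Matrix.trace_diagonal]
  simp [sq]

/-- Relative singular value decomposition: if `B'⁻¹ BᵀB B'⁻¹` is Frobenius-close to the identity,
then `B = V L Uᵀ B'` with `U`, `V` orthogonal and `L` diagonal and close to the identity. -/
lemma exists_orthogonal_decomposition {ι : Type*} [Fintype ι] [DecidableEq ι]
    {B B' : Matrix ι ι ℝ} (hB' : B'ᵀ = B') (hu : IsUnit B'.det) {η : ℝ} (hη : η ≤ 1 / 4)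
    (h : ∑ i, ∑ j, (B'⁻¹ * (Bᵀ * B) * B'⁻¹ - 1) i j ^ 2 ≤ η) :
    ∃ (U V : Matrix ι ι ℝ) (e : ι → ℝ), U * Uᵀ = 1 ∧ V * Vᵀ = 1 ∧
      B = V * diagonal (fun j => √(1 + e j)) * Uᵀ * B' ∧ ∑ j, e j ^ 2 ≤ η := by
  set T : Matrix ι ι ℝ := B * B'⁻¹ with hT
  have hTT : B'⁻¹ * (Bᵀ * B) * B'⁻¹ = Tᵀ * T := by
    rw [hT, Matrix.transpose_mul, Matrix.transpose_nonsing_inv, hB']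
    simp only [Matrix.mul_assoc]
  rw [hTT] at h
  have hE : (Tᵀ * T - 1).IsHermitian := by
    rw [Matrix.IsHermitian, Matrix.conjTranspose_eq_transpose_of_trivial]
    simp
  set e := hE.eigenvalues with he
  have hsum : ∑ j, e j ^ 2 ≤ η := by rwa [he, sum_eigenvalues_sq]
  have hpos (j : ι) : 0 < 1 + e j := by
    have := Finset.single_le_sum (fun i _ => sq_nonneg (e i)) (Finset.mem_univ j)
    nlinarith
  set U : Matrix ι ι ℝ := (hE.eigenvectorUnitary : Matrix ι ι ℝ) with hU
  have hUU : U * Uᵀ = 1 := by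
    have := Unitary.coe_mul_star_self hE.eigenvectorUnitary
    simpa [Matrix.star_eq_conjTranspose, ← hU] using this
  have hUU' : Uᵀ * U = 1 := mul_eq_one_comm.1 hUU
  have hdec : Tᵀ * T = U * diagonal (fun j => 1 + e j) * Uᵀ := by
    have h1 := hE.spectral_theorem
    rw [Unitary.conjStarAlgAut_apply, sub_eq_iff_eq_add] at h1
    have h2 : diagonal (fun j => 1 + e j) = diagonal e + 1 := by
      rw [← Matrix.diagonal_one, Matrix.diagonal_add]
      simp [add_comm]
    rw [h1, h2, Matrix.mul_add, Matrix.add_mul, Matrix.mul_one, hUU]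
    rfl
  set L : Matrix ι ι ℝ := diagonal (fun j => √(1 + e j)) with hL
  set L' : Matrix ι ι ℝ := diagonal (fun j => (√(1 + e j))⁻¹) with hL'
  have hLL : L' * L = 1 := by
    rw [hL, hL', Matrix.diagonal_mul_diagonal, ← Matrix.diagonal_one]
    congr 1
    ext j
    exact inv_mul_cancel₀ (Real.sqrt_pos.2 (hpos j)).ne'
  have hsq : diagonal (fun j => 1 + e j) = L * L := by
    rw [hL, Matrix.diagonal_mul_diagonal]
    congr 1
    ext j
    exact (Real.mul_self_sqrt (hpos j).le).symm
  have hLL' : L * L' = 1 := mul_eq_one_comm.1 hLL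
  refine ⟨U, T * U * L', e, hUU, ?_, ?_, hsum⟩
  · rw [mul_eq_one_comm]
    calc (T * U * L')ᵀ * (T * U * L') = L' * Uᵀ * (Tᵀ * T) * U * L' := by
          simp only [Matrix.transpose_mul, Matrix.mul_assoc, hL', Matrix.diagonal_transpose]
      _ = L' * (Uᵀ * U) * L * L * (Uᵀ * U) * L' := by
          rw [hdec, hsq]; simp only [Matrix.mul_assoc]
      _ = 1 := by
          rw [hUU', Matrix.mul_one, Matrix.mul_one, hLL, Matrix.one_mul, hLL']
  · calc B = T * B' := by
          rw [hT, Matrix.mul_assoc, Matrix.nonsing_inv_mul _ hu, Matrix.mul_one]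
      _ = T * (U * (L' * L) * Uᵀ) * B' := by rw [hLL, Matrix.mul_one, hUU, Matrix.mul_one]
      _ = T * U * L' * L * Uᵀ * B' := by simp only [Matrix.mul_assoc]

lemma exists_centerMat_eq_add_vecMulVec {n d : ℕ} (hn : 0 < n) {A A' : Matrix (Fin n) (Fin d) ℝ}
    (h : MatNeighbors A A') : ∃ (u : Fin n → ℝ) (v : Fin d → ℝ), u ⬝ᵥ u ≤ 1 ∧ v ⬝ᵥ v ≤ 1 ∧
      centerMat A' = centerMat A + vecMulVec u v := by
  obtain ⟨i, v, hv, rfl⟩ := h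
  have hn' : (0 : ℝ) < n := by exact_mod_cast hn
  refine ⟨fun k => (if k = i then 1 else 0) - (n : ℝ)⁻¹, v, ?_, ?_, ?_⟩
  · have h1 (k : Fin n) : ((if k = i then 1 else 0) - (n : ℝ)⁻¹) *
        ((if k = i then 1 else 0) - (n : ℝ)⁻¹) =
        (if k = i then 1 - 2 * (n : ℝ)⁻¹ else 0) + (n : ℝ)⁻¹ ^ 2 := by
      split_ifs <;> ring
    simp only [dotProduct, h1, Finset.sum_add_distrib, Finset.sum_ite_eq', Finset.mem_univ,
      if_true, Finset.sum_const, Finset.card_univ, Fintype.card_fin, nsmul_eq_mul]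
    have h2 : (n : ℝ) * (n : ℝ)⁻¹ ^ 2 = (n : ℝ)⁻¹ := by field_simp
    rw [h2]
    have := inv_pos.2 hn'
    linarith
  · rw [Real.sqrt_le_one] at hv
    simpa [dotProduct, sq] using hv
  · ext k j
    simp only [centerMat, Matrix.sub_apply, Matrix.add_apply, Matrix.smul_apply, Matrix.mul_apply,
      Matrix.of_apply, vecMulVec_apply, smul_eq_mul, one_mul, Finset.sum_add_distrib,
      Finset.sum_ite_eq', Finset.mem_univ, if_true]
    split_ifs <;> ring

lemma sum_sq_inv_mul_sub_one_le {m ι : Type*} [Fintype m] [Fintype ι] [DecidableEq ι]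
    {X X' : Matrix m ι ℝ} {u : m → ℝ} {v : ι → ℝ} (hu : u ⬝ᵥ u ≤ 1) (hv : v ⬝ᵥ v ≤ 1)
    (hX : X' = X + vecMulVec u v) {B B' : Matrix ι ι ℝ} {w : ℝ} (hw : 1 ≤ w)
    (hB2 : B * B = Xᵀ * X + (w ^ 2) • 1) (hB' : B'ᵀ = B')
    (hB'2 : B' * B' = X'ᵀ * X' + (w ^ 2) • 1) :
    ∑ i, ∑ j, (B'⁻¹ * (B * B) * B'⁻¹ - 1) i j ^ 2 ≤ 9 / w ^ 2 := by
  have hw0 : 0 < w := by linarith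
  have hdet := isUnit_det_of_mul_self hB' hw0 hB'2
  have hinv : B'⁻¹ᵀ = B'⁻¹ := by rw [Matrix.transpose_nonsing_inv, hB']
  have hBB : B * B = B' * B' + ((u ⬝ᵥ u) • vecMulVec v v -
      (vecMulVec (X'ᵀ *ᵥ u) v + vecMulVec v (X'ᵀ *ᵥ u))) := by
    obtain rfl : X = X' - vecMulVec u v := by rw [hX, add_sub_cancel_right]
    rw [hB2, hB'2, Matrix.transpose_sub, Matrix.transpose_vecMulVec, Matrix.sub_mul,
      Matrix.mul_sub, Matrix.mul_sub, Matrix.mul_vecMulVec, Matrix.vecMulVec_mul,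
      Matrix.vecMulVec_mul_vecMulVec, Matrix.mulVec_transpose]
    simp only [Matrix.vecMulVec_smul]
    abel
  have hE : B'⁻¹ * (B * B) * B'⁻¹ - 1 = (u ⬝ᵥ u) • vecMulVec (B'⁻¹ *ᵥ v) (B'⁻¹ *ᵥ v) -
      (vecMulVec (B'⁻¹ *ᵥ (X'ᵀ *ᵥ u)) (B'⁻¹ *ᵥ v) +
        vecMulVec (B'⁻¹ *ᵥ v) (B'⁻¹ *ᵥ (X'ᵀ *ᵥ u))) := by
    have h1 : B'⁻¹ * (B' * B') * B'⁻¹ = 1 := by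
      rw [← Matrix.mul_assoc, Matrix.nonsing_inv_mul _ hdet, Matrix.one_mul,
        Matrix.mul_nonsing_inv _ hdet]
    have h2 (x y : ι → ℝ) : B'⁻¹ * vecMulVec x y * B'⁻¹ =
        vecMulVec (B'⁻¹ *ᵥ x) (B'⁻¹ *ᵥ y) := by
      rw [Matrix.mul_vecMulVec, Matrix.vecMulVec_mul, ← Matrix.mulVec_transpose, hinv]
    rw [hBB, Matrix.mul_add, Matrix.add_mul, h1, add_sub_cancel_left, Matrix.mul_sub,
      Matrix.sub_mul, Matrix.mul_add, Matrix.add_mul, Matrix.mul_smul, Matrix.smul_mul, h2, h2, h2]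
  rw [hE]
  exact sum_sq_rank_two_le hw (inv_mulVec_transpose_mulVec_le hB' hw0 hB'2 hu)
    (inv_mulVec_le hB' hw0 hB'2 hv) (zero_le_dotProduct_self u) hu

lemma noise_bounds {ε δ : ℝ} (hε : 0 < ε ∧ ε < 1) (hδ : 0 < δ ∧ δ < 1) {r : ℕ} (hr : 0 < r)
    {w : ℝ} (hw : w = 16 * Real.sqrt (r * Real.log (2 / δ)) / ε * Real.log (16 * r / δ)) :
    1 ≤ w ∧ 1 ≤ 2 * Real.log (2 / δ) / ε ∧
      r * ((2 * Real.log (2 / δ) / ε) ^ 2 * (9 / w ^ 2)) ≤ Real.log (2 / δ) / 4 ∧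
      (2 * Real.log (2 / δ) / ε) ^ 2 * (9 / w ^ 2) ≤ 1 / 4 := by
  obtain ⟨hε0, hε1⟩ := hε
  obtain ⟨hδ0, hδ1⟩ := hδ
  have hr1 : (1 : ℝ) ≤ r := by exact_mod_cast hr
  set l := Real.log (2 / δ) with hl
  set k := Real.log (16 * r / δ) with hk
  have hl2 : 0.69 < l := by
    have : Real.log 2 ≤ l := Real.log_le_log (by norm_num) (by
      rw [le_div_iff₀ hδ0]; linarith)
    linarith [Real.log_two_gt_d9]
  have hlk : l ≤ k := Real.log_le_log (by positivity) (by gcongr; linarith)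
  have hk1 : 1 ≤ k := by
    have h16 : Real.log 16 ≤ k := Real.log_le_log (by norm_num) (by
      rw [le_div_iff₀ hδ0]; nlinarith)
    have : Real.log 16 = 4 * Real.log 2 := by
      rw [show (16 : ℝ) = 2 ^ 4 by norm_num, Real.log_pow]; norm_num
    linarith [Real.log_two_gt_d9]
  have hl0 : 0 < l := by linarith
  have hk0 : 0 < k := by linarith
  have hw0 : 0 < w := by rw [hw]; positivity
  have hw2 : w ^ 2 = 256 * (r * l) * k ^ 2 / ε ^ 2 := by
    rw [hw, mul_pow, div_pow, mul_pow, Real.sq_sqrt (by positivity)]; ring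
  have hkk : l ≤ k ^ 2 := by nlinarith
  have key : (2 * l / ε) ^ 2 * (9 / w ^ 2) = 9 / 64 * (l / (r * k ^ 2)) := by
    rw [hw2]; field_simp; norm_num
  refine ⟨?_, ?_, ?_, ?_⟩
  · have : 1 ≤ w ^ 2 := by
      rw [hw2, le_div_iff₀ (by positivity)]
      have h1 : 0.69 ≤ r * l := by nlinarith
      have h2 : 1 ≤ k ^ 2 := one_le_pow₀ hk1
      have h3 : ε ^ 2 ≤ 1 := pow_le_one₀ hε0.le hε1.le
      nlinarith
    nlinarith
  · rw [le_div_iff₀ hε0]; linarith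
  · have : r * (9 / 64 * (l / (r * k ^ 2))) = 9 / 64 * l / k ^ 2 := by field_simp
    rw [key, this, div_le_iff₀ (by positivity)]
    nlinarith [mul_le_mul_of_nonneg_left (one_le_pow₀ hk1 : 1 ≤ k ^ 2) hl0.le]
  · have : l / (r * k ^ 2) ≤ 1 := by
      rw [div_le_one (by positivity)]
      nlinarith [sq_nonneg k]
    rw [key]
    linarith

/-- Theorem 4.1: the JL covariance-matrix algorithm preserves `(ε,δ)`-differential privacy.
`B` (resp. `B'`) is the positive semidefinite square root of `ĀᵀĀ + w²I` (resp. for `A'`). -/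
theorem jl_covariance_privacy {n d : ℕ} (hn : 0 < n) (hd : 0 < d) {ε δ : ℝ}
    (hε : 0 < ε ∧ ε < 1) (hδ : 0 < δ ∧ δ < 1) {r : ℕ} (hr : 0 < r) {w : ℝ}
    (hw : w = 16 * Real.sqrt (r * Real.log (2 / δ)) / ε * Real.log (16 * r / δ))
    {A A' : Matrix (Fin n) (Fin d) ℝ} (hnb : MatNeighbors A A')
    {B B' : Matrix (Fin d) (Fin d) ℝ}
    (hB : B.PosSemidef)
    (hB2 : B * B = (centerMat A)ᵀ * centerMat A + (w ^ 2) • (1 : Matrix (Fin d) (Fin d) ℝ))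
    (hB' : B'.PosSemidef)
    (hB'2 : B' * B' = (centerMat A')ᵀ * centerMat A' + (w ^ 2) • (1 : Matrix (Fin d) (Fin d) ℝ))
    {S : Set (Matrix (Fin d) (Fin d) ℝ)} (hS : MeasurableSet S) :
    Measure.map (fun M : Matrix (Fin r) (Fin d) ℝ => ((r : ℝ)⁻¹) • (Bᵀ * Mᵀ * M * B))
      (stdGaussianMatrix (Fin r) (Fin d)) S
    ≤ ENNReal.ofReal (Real.exp ε) *
      Measure.map (fun M : Matrix (Fin r) (Fin d) ℝ => ((r : ℝ)⁻¹) • (B'ᵀ * Mᵀ * M * B'))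
        (stdGaussianMatrix (Fin r) (Fin d)) S
    + ENNReal.ofReal δ := by
  obtain ⟨hw1, ht1, hrt, htw⟩ := noise_bounds hε hδ hr hw
  set t := 2 * Real.log (2 / δ) / ε with ht
  have hBT : Bᵀ = B := by simpa [Matrix.IsHermitian] using hB.isHermitian
  have hB'T : B'ᵀ = B' := by simpa [Matrix.IsHermitian] using hB'.isHermitian
  obtain ⟨u, v, hu, hv, huv⟩ := exists_centerMat_eq_add_vecMulVec hn hnb
  have hsum := sum_sq_inv_mul_sub_one_le hu hv huv hw1 hB2 hB'T hB'2
  have hη0 : 0 ≤ 9 / w ^ 2 := by positivity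
  have hη : 9 / w ^ 2 ≤ 1 / 4 := by nlinarith [one_le_pow₀ ht1 (n := 2)]
  nth_rewrite 1 [← hBT] at hsum
  obtain ⟨U, V, e, hU, hV, hBeq, he⟩ := exists_orthogonal_decomposition hB'T
    (isUnit_det_of_mul_self hB'T (by linarith) hB'2) hη hsum
  have hej (j : Fin d) : e j ^ 2 ≤ 9 / w ^ 2 :=
    (Finset.single_le_sum (fun i _ => sq_nonneg (e i)) (Finset.mem_univ j)).trans he
  let D : Matrix (Fin r) (Fin d) ℝ → Matrix (Fin r) (Fin d) ℝ := fun M k j => M k j * √(1 + e j)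
  let G : Matrix (Fin r) (Fin d) ℝ → Matrix (Fin d) (Fin d) ℝ :=
    fun M => ((r : ℝ)⁻¹) • ((M * (Uᵀ * B'))ᵀ * (M * (Uᵀ * B')))
  have hD : Measurable D := by
    refine measurable_pi_lambda _ fun k => measurable_pi_lambda _ fun j => ?_
    exact ((measurable_pi_apply j).comp (measurable_pi_apply k)).mul_const _
  have hG : Measurable G := by
    have hm := measurable_matrix_mul_const (m := Fin r) (Uᵀ * B')
    refine measurable_pi_lambda _ fun i => measurable_pi_lambda _ fun j => ?_
    have hij : Measurable fun M : Matrix (Fin r) (Fin d) ℝ =>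
        (r : ℝ)⁻¹ * ∑ k, (M * (Uᵀ * B')) k i * (M * (Uᵀ * B')) k j := by
      refine (Finset.measurable_sum _ fun k _ => ?_).const_mul _
      exact ((measurable_pi_apply i).comp ((measurable_pi_apply k).comp hm)).mul
        ((measurable_pi_apply j).comp ((measurable_pi_apply k).comp hm))
    exact hij
  have hDeq (M : Matrix (Fin r) (Fin d) ℝ) : D M = M * diagonal fun j => √(1 + e j) := by
    ext k j
    simp [D]
  have h1 : (fun M : Matrix (Fin r) (Fin d) ℝ => ((r : ℝ)⁻¹) • (Bᵀ * Mᵀ * M * B)) =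
      G ∘ D ∘ fun M => M * V := by
    ext1 M
    have : M * V * diagonal (fun j => √(1 + e j)) * (Uᵀ * B') = M * B := by
      rw [hBeq]; simp only [Matrix.mul_assoc]
    simp only [G, Function.comp_apply, hDeq, this]
    simp only [Matrix.transpose_mul, Matrix.mul_assoc]
  have h2 : (fun M : Matrix (Fin r) (Fin d) ℝ => ((r : ℝ)⁻¹) • (B'ᵀ * Mᵀ * M * B')) =
      G ∘ fun M => M * U := by
    ext1 M
    have : M * U * (Uᵀ * B') = M * B' := by
      rw [Matrix.mul_assoc, ← Matrix.mul_assoc U, hU, Matrix.one_mul]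
    simp only [G, Function.comp_apply, this]
    simp only [Matrix.transpose_mul, Matrix.mul_assoc]
  rw [h1, h2, ← Measure.map_map hG (hD.comp (measurable_matrix_mul_const V)),
    ← Measure.map_map hD (measurable_matrix_mul_const V), stdGaussianMatrix_map_mul hV,
    ← Measure.map_map hG (measurable_matrix_mul_const U), stdGaussianMatrix_map_mul hU,
    Measure.map_apply hG hS, Measure.map_apply hG hS]
  have ht0 : 0 ≤ t := by linarith
  refine (stdGaussianMatrix_map_mul_sqrt_le (s := e) ε ht0 (fun j => ?_) (fun j => ?_)
    (hG hS)).trans ?_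
  · nlinarith [hej j]
  · have : (t * e j) ^ 2 ≤ 1 / 4 := by
      rw [mul_pow]
      exact (mul_le_mul_of_nonneg_left (hej j) (sq_nonneg t)).trans htw
    nlinarith
  · gcongr
    rw [← Real.le_log_iff_exp_le hδ.1, Fintype.card_fin]
    have hl : Real.log (2 / δ) = Real.log 2 - Real.log δ :=
      Real.log_div two_ne_zero hδ.1.ne'
    have hl2 : 0 < Real.log 2 := Real.log_pos one_lt_two
    have hl0 : 0 < Real.log (2 / δ) :=
      Real.log_pos (by rw [lt_div_iff₀ hδ.1]; linarith [hδ.2])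
    have htε : t * ε = 2 * Real.log (2 / δ) := div_mul_cancel₀ _ hε.1.ne'
    have hr0 : (0 : ℝ) ≤ r := r.cast_nonneg
    have h3 : r * ((t + t ^ 2) * ∑ j, e j ^ 2) ≤ r * ((2 * t ^ 2) * (9 / w ^ 2)) := by
      gcongr
      nlinarith
    linarith
end
end

section
/- Approximate density domination in the other direction for a single Gaussian projection of a graph (Claim 3.3, inequality (2), measure form): Let n ≥ 2, w ≥ 2 with w ≤ n/2, let ε₀ > 0 and δ₀ ∈ (0,1) satisfy ε₀ ≥ 8·ln(4/δ₀)/w. Let ω, ω′ be weighted graphs on Fin n such that ω(u,v) ≥ w/n for all u ≠ v, and such that ω′ agrees with ω except on one pair {a,b} (a ≠ b), where ω′(a,b) = ω(a,b) + c for some 0 < c ≤ 1. Let ν_ω be the pushforward of the standard Gaussian measure γ_P on ℝ^P under y ↦ E_ωᵀ y, and similarly ν_{ω′}. Then for every measurable set S ⊆ ℝ^n, ν_{ω′}(S) ≤ e^{ε₀} · ν_ω(S) + δ₀. -/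
open MeasureTheory ProbabilityTheory Matrix

noncomputable section

open scoped NNReal ENNReal

lemma charFunDual_map_mulVec_stdGaussianPi {ι κ : Type*} [Fintype ι] [Fintype κ]
    [DecidableEq ι] (M : Matrix ι κ ℝ) (L : StrongDual ℝ (ι → ℝ)) :
    charFunDual ((stdGaussianPi κ).map (M *ᵥ ·)) L =
      Complex.exp (-(((fun i => L (Pi.single i 1)) ⬝ᵥ
        (M * Mᵀ) *ᵥ fun i => L (Pi.single i 1) : ℝ) : ℂ) / 2) := by
  set l : ι → ℝ := fun i => L (Pi.single i 1)
  have hL : ∀ x : ι → ℝ, L x = l ⬝ᵥ x := fun x => by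
    conv_lhs => rw [← Finset.univ_sum_single x, map_sum]
    refine Finset.sum_congr rfl fun i _ => ?_
    have : Pi.single i (x i) = x i • (Pi.single i 1 : ι → ℝ) := by
      rw [← Pi.single_smul]; simp
    rw [this, map_smul, smul_eq_mul, mul_comm]
  have hquad : l ⬝ᵥ (M * Mᵀ) *ᵥ l = ∑ j, (l ᵥ* M) j ^ 2 := by
    rw [← Matrix.mulVec_mulVec, Matrix.dotProduct_mulVec, Matrix.mulVec_transpose]
    exact Finset.sum_congr rfl fun j _ => (sq _).symm
  have hmeas : Measurable (M *ᵥ · : (κ → ℝ) → ι → ℝ) := by fun_prop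
  rw [hquad, charFunDual_apply, integral_map hmeas.aemeasurable (by fun_prop)]
  have hint : ∀ y : κ → ℝ, Complex.exp (L (M *ᵥ y) * Complex.I) =
      ∏ j, Complex.exp (((l ᵥ* M) j : ℂ) * (y j : ℂ) * Complex.I) := fun y => by
    rw [hL, Matrix.dotProduct_mulVec, dotProduct, Complex.ofReal_sum, Finset.sum_mul,
      Complex.exp_sum]
    simp
  simp_rw [hint]
  rw [stdGaussianPi, integral_fintype_prod_eq_prod
    (f := fun j (t : ℝ) => Complex.exp (((l ᵥ* M) j : ℂ) * (t : ℂ) * Complex.I))]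
  simp_rw [← charFun_apply_real, charFun_gaussianReal]
  rw [← Complex.exp_sum]
  simp [Finset.sum_div, neg_div]

lemma map_mulVec_stdGaussianPi_congr {ι κ κ' : Type*} [Fintype ι] [Fintype κ] [Fintype κ']
    [DecidableEq ι] {M : Matrix ι κ ℝ} {N : Matrix ι κ' ℝ} (h : M * Mᵀ = N * Nᵀ) :
    (stdGaussianPi κ).map (M *ᵥ ·) = (stdGaussianPi κ').map (N *ᵥ ·) := by
  have hM : Measurable (M *ᵥ · : (κ → ℝ) → ι → ℝ) := by fun_prop
  have hN : Measurable (N *ᵥ · : (κ' → ℝ) → ι → ℝ) := by fun_prop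
  have := Measure.isProbabilityMeasure_map (μ := stdGaussianPi κ) hM.aemeasurable
  have := Measure.isProbabilityMeasure_map (μ := stdGaussianPi κ') hN.aemeasurable
  refine Measure.ext_of_charFunDual (funext fun L => ?_)
  rw [charFunDual_map_mulVec_stdGaussianPi, charFunDual_map_mulVec_stdGaussianPi, h]

lemma map_fromCols_stdGaussianPi_apply {ι κ : Type*} [Fintype ι] [Fintype κ]
    (M : Matrix ι κ ℝ) (b : ι → ℝ) (v : ℝ≥0) {S : Set (ι → ℝ)} (hS : MeasurableSet S) :
    (stdGaussianPi (κ ⊕ Unit)).map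
        (Matrix.fromCols M (Matrix.replicateCol Unit (√(v : ℝ) • b)) *ᵥ ·) S =
      ∫⁻ y, gaussianReal 0 v {t | M *ᵥ y + t • b ∈ S} ∂stdGaussianPi κ := by
  have hpres := measurePreserving_sumPiEquivProdPi_symm (X := fun _ : κ ⊕ Unit => ℝ)
    (fun _ => gaussianReal 0 1)
  have hpi : stdGaussianPi (κ ⊕ Unit) = Measure.map
      (MeasurableEquiv.sumPiEquivProdPi fun _ : κ ⊕ Unit => ℝ).symm
      ((stdGaussianPi κ).prod (stdGaussianPi Unit)) := hpres.map_eq.symm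
  have hmul : Measurable
      (Matrix.fromCols M (Matrix.replicateCol Unit (√(v : ℝ) • b)) *ᵥ · :
        (κ ⊕ Unit → ℝ) → ι → ℝ) := by
    fun_prop
  rw [hpi, Measure.map_map hmul (MeasurableEquiv.measurable _),
    Measure.map_apply (hmul.comp (MeasurableEquiv.measurable _)) hS,
    Measure.prod_apply ((hmul.comp (MeasurableEquiv.measurable _)) hS)]
  refine lintegral_congr fun y => ?_
  have hT : MeasurableSet {t : ℝ | M *ᵥ y + t • b ∈ S} := by
    have : Measurable fun t : ℝ => M *ᵥ y + t • b := by fun_prop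
    exact this hS
  have hσ : gaussianReal 0 v = (gaussianReal 0 1).map (√(v : ℝ) * ·) := by
    rw [gaussianReal_map_const_mul, mul_zero, mul_one]
    congr 1
    ext
    simp
  have hunit : gaussianReal 0 1 = (stdGaussianPi Unit).map (fun z => z ()) :=
    (measurePreserving_eval (fun _ : Unit => gaussianReal 0 1) ()).map_eq.symm
  rw [hσ, Measure.map_apply (by fun_prop) hT, hunit,
    Measure.map_apply (by fun_prop) ((measurable_const_mul √(v : ℝ)) hT)]
  congr 1
  ext z
  have : Matrix.fromCols M (Matrix.replicateCol Unit (√(v : ℝ) • b)) *ᵥ Sum.elim y z =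
      M *ᵥ y + (√(v : ℝ) * z ()) • b := by
    rw [Matrix.fromCols_mulVec_sumElim]
    congr 1
    ext i
    simp [Matrix.mulVec, dotProduct]
    ring
  simp only [Set.mem_preimage, Set.mem_ofPred_eq, ← this]
  rfl

lemma gaussianReal_Ici_le {v : ℝ≥0} (hv : v ≠ 0) {r : ℝ} (hr : 0 ≤ r) :
    gaussianReal 0 v (Set.Ici r) ≤ ENNReal.ofReal (Real.exp (-(r ^ 2 / (2 * v)))) := by
  have hv' : (0 : ℝ) < v := by positivity
  have h := measure_ge_le_exp_mul_mgf (μ := gaussianReal 0 v) (X := id) r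
    (t := r / v) (by positivity) (integrable_exp_mul_gaussianReal _)
  rw [mgf_id_gaussianReal, ← Real.exp_add] at h
  rw [← ofReal_measureReal]
  refine ENNReal.ofReal_le_ofReal (h.trans_eq ?_)
  congr 1
  field_simp
  ring

lemma gaussianReal_Iic_neg_le {v : ℝ≥0} (hv : v ≠ 0) {r : ℝ} (hr : 0 ≤ r) :
    gaussianReal 0 v (Set.Iic (-r)) ≤ ENNReal.ofReal (Real.exp (-(r ^ 2 / (2 * v)))) := by
  have h : gaussianReal 0 v = (gaussianReal 0 v).map (fun x => -x) := by
    rw [gaussianReal_map_neg, neg_zero]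
  rw [h, Measure.map_apply measurable_neg measurableSet_Iic]
  simpa using gaussianReal_Ici_le hv hr

lemma gaussianPDF_zero_le_exp_mul {v v' : ℝ≥0} (hv : v ≠ 0) (hvv : v < v') {ε x : ℝ}
    (hx : x ^ 2 ≤ 2 * ε * v * v' / (v' - v)) :
    gaussianPDF 0 v' x ≤ ENNReal.ofReal (Real.exp ε) * gaussianPDF 0 v x := by
  have hv0 : (0 : ℝ) < v := by positivity
  have hlt : (v : ℝ) < v' := by exact_mod_cast hvv
  have hv0' : (0 : ℝ) < v' := hv0.trans hlt
  rw [gaussianPDF, gaussianPDF, ← ENNReal.ofReal_mul (Real.exp_nonneg _)]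
  refine ENNReal.ofReal_le_ofReal ?_
  rw [gaussianPDFReal, gaussianPDFReal, mul_left_comm, ← Real.exp_add]
  gcongr
  rw [le_div_iff₀ (by linarith)] at hx
  have : ε + -(x - 0) ^ 2 / (2 * v) - -(x - 0) ^ 2 / (2 * v') =
      (2 * ε * v * v' - x ^ 2 * (v' - v)) / (2 * v * v') := by
    field_simp
    ring
  have : 0 ≤ (2 * ε * v * v' - x ^ 2 * (v' - v)) / (2 * v * v') :=
    div_nonneg (by linarith) (by positivity)
  linarith

/-- A centred Gaussian is approximately dominated by one of smaller variance. -/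
lemma gaussianReal_le_exp_mul_add {v v' : ℝ≥0} (hv : v ≠ 0) (hvv : v < v') {ε : ℝ}
    (hε : 0 ≤ ε) {T : Set ℝ} (hT : MeasurableSet T) :
    gaussianReal 0 v' T ≤ ENNReal.ofReal (Real.exp ε) * gaussianReal 0 v T +
      ENNReal.ofReal (2 * Real.exp (-(ε * v / (v' - v)))) := by
  have hv0 : (0 : ℝ) < v := by positivity
  have hlt : (v : ℝ) < v' := by exact_mod_cast hvv
  have hv0' : (0 : ℝ) < v' := hv0.trans hlt
  have hv' : v' ≠ 0 := by exact_mod_cast hv0'.ne'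
  have hsub : (0 : ℝ) < v' - v := by linarith
  set q : ℝ := 2 * ε * v * v' / (v' - v) with hq
  have hq0 : 0 ≤ q := by positivity
  set G : Set ℝ := {x | x ^ 2 ≤ q}
  have hGm : MeasurableSet G := measurableSet_le (by fun_prop) measurable_const
  have hcover : T ⊆ T ∩ G ∪ (Set.Ici √q ∪ Set.Iic (-√q)) := fun x hx => by
    by_cases hxG : x ^ 2 ≤ q
    · exact .inl ⟨hx, hxG⟩
    · right
      have : √q ≤ |x| := Real.sqrt_le_sqrt (not_le.mp hxG).le |>.trans_eq (Real.sqrt_sq_eq_abs x)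
      rcases le_abs.mp this with h | h
      · exact .inl h
      · exact .inr (by simpa using neg_le_neg h)
  have hgood : gaussianReal 0 v' (T ∩ G) ≤
      ENNReal.ofReal (Real.exp ε) * gaussianReal 0 v T := by
    rw [gaussianReal_apply 0 hv', gaussianReal_apply 0 hv,
      ← lintegral_const_mul _ (measurable_gaussianPDF _ _)]
    refine (setLIntegral_mono' (hT.inter hGm) fun x hx =>
      gaussianPDF_zero_le_exp_mul hv hvv hx.2).trans ?_
    exact lintegral_mono_set Set.inter_subset_left
  have hexp : √q ^ 2 / (2 * v') = ε * v / (v' - v) := by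
    rw [Real.sq_sqrt hq0, hq]
    field_simp
  have h1 := gaussianReal_Ici_le hv' (Real.sqrt_nonneg q)
  have h2 := gaussianReal_Iic_neg_le hv' (Real.sqrt_nonneg q)
  rw [hexp] at h1 h2
  calc gaussianReal 0 v' T
      ≤ gaussianReal 0 v' (T ∩ G) +
          (gaussianReal 0 v' (Set.Ici √q) + gaussianReal 0 v' (Set.Iic (-√q))) :=
        (measure_mono hcover).trans ((measure_union_le _ _).trans
          (add_le_add_right (measure_union_le _ _) _))
    _ ≤ _ := by
        rw [two_mul, ENNReal.ofReal_add (by positivity) (by positivity)]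
        gcongr

/-- If `M Mᵀ v = d`, subtracting from `M` its component along `d` removes `d dᵀ / (v ⬝ d)` from the
covariance `M Mᵀ`; a column proportional to `d` then adds a multiple of `d dᵀ` back. -/
lemma fromCols_replicateCol_mul_transpose {ι κ : Type*} [Fintype ι] [Fintype κ] [DecidableEq ι]
    {M : Matrix ι κ ℝ} {v d : ι → ℝ} (hv : (M * Mᵀ) *ᵥ v = d) (hs : v ⬝ᵥ d ≠ 0) {t : ℝ}
    (ht : 0 ≤ t) :
    Matrix.fromCols ((1 - (v ⬝ᵥ d)⁻¹ • Matrix.vecMulVec d v) * M)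
        (Matrix.replicateCol Unit (√t • d)) *
      (Matrix.fromCols ((1 - (v ⬝ᵥ d)⁻¹ • Matrix.vecMulVec d v) * M)
        (Matrix.replicateCol Unit (√t • d)))ᵀ =
      M * Mᵀ + (t - (v ⬝ᵥ d)⁻¹) • Matrix.vecMulVec d d := by
  have hv' : v ᵥ* (M * Mᵀ) = d := by
    rw [← Matrix.mulVec_transpose, Matrix.transpose_mul, Matrix.transpose_transpose, hv]
  have hcol : Matrix.replicateCol Unit (√t • d) * (Matrix.replicateCol Unit (√t • d))ᵀ =
      t • Matrix.vecMulVec d d := by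
    rw [Matrix.transpose_replicateCol, ← Matrix.vecMulVec_eq, Matrix.smul_vecMulVec,
      Matrix.vecMulVec_smul, smul_smul, Real.mul_self_sqrt ht]
  rw [Matrix.transpose_fromCols, Matrix.fromCols_mul_fromRows, hcol, Matrix.transpose_mul,
    Matrix.mul_assoc, ← Matrix.mul_assoc M, ← Matrix.mul_assoc, Matrix.sub_mul, Matrix.one_mul,
    Matrix.smul_mul, Matrix.vecMulVec_mul, hv', Matrix.transpose_sub, Matrix.transpose_one,
    Matrix.transpose_smul, Matrix.transpose_vecMulVec, Matrix.mul_sub, Matrix.mul_one,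
    Matrix.mul_smul, Matrix.sub_mul, Matrix.mul_vecMulVec, hv, Matrix.smul_mul,
    Matrix.vecMulVec_mul_vecMulVec, dotProduct_comm d v, Matrix.vecMulVec_smul, smul_smul,
    inv_mul_cancel₀ hs, one_smul, sub_self, smul_zero, sub_zero, sub_smul]
  abel

/-- Approximate domination of linear images of a standard Gaussian whose covariances differ by the
rank-one matrix `c d dᵀ`, where `d` is in the range of the smaller covariance. -/
theorem map_mulVec_stdGaussianPi_le {ι κ : Type*} [Fintype ι] [Fintype κ] [DecidableEq ι]
    {M M' : Matrix ι κ ℝ} {v d : ι → ℝ} {c ε : ℝ}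
    (hv : (M * Mᵀ) *ᵥ v = d) (hs : 0 < v ⬝ᵥ d) (hc : 0 < c) (hε : 0 ≤ ε)
    (hM' : M' * M'ᵀ = M * Mᵀ + c • Matrix.vecMulVec d d)
    {S : Set (ι → ℝ)} (hS : MeasurableSet S) :
    (stdGaussianPi κ).map (M' *ᵥ ·) S ≤
      ENNReal.ofReal (Real.exp ε) * (stdGaussianPi κ).map (M *ᵥ ·) S +
        ENNReal.ofReal (2 * Real.exp (-(ε / (c * (v ⬝ᵥ d))))) := by
  set s := v ⬝ᵥ d
  set B : Matrix ι κ ℝ := (1 - s⁻¹ • Matrix.vecMulVec d v) * M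
  have hlaw : ∀ (r : ℝ≥0) {N : Matrix ι κ ℝ},
      N * Nᵀ = M * Mᵀ + ((r : ℝ) - s⁻¹) • Matrix.vecMulVec d d →
      (stdGaussianPi κ).map (N *ᵥ ·) S =
        ∫⁻ y, gaussianReal 0 r {t | B *ᵥ y + t • d ∈ S} ∂stdGaussianPi κ := by
    intro r N hN
    rw [← map_fromCols_stdGaussianPi_apply _ _ _ hS]
    exact congrArg (· S) (map_mulVec_stdGaussianPi_congr
      (hN.trans (fromCols_replicateCol_mul_transpose hv hs.ne' r.2).symm))
  have hr : ((s⁻¹.toNNReal : ℝ≥0) : ℝ) = s⁻¹ := Real.coe_toNNReal _ (by positivity)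
  have hr' : (((s⁻¹ + c).toNNReal : ℝ≥0) : ℝ) = s⁻¹ + c := Real.coe_toNNReal _ (by positivity)
  have hr0 : s⁻¹.toNNReal ≠ 0 := by simpa using hs
  have hlt : s⁻¹.toNNReal < (s⁻¹ + c).toNNReal := by
    rw [← NNReal.coe_lt_coe, hr, hr']; linarith
  have hexp : ε * s⁻¹ / (s⁻¹ + c - s⁻¹) = ε / (c * s) := by
    rw [add_sub_cancel_left]; field_simp
  have hmeas : ∀ y, MeasurableSet {t : ℝ | B *ᵥ y + t • d ∈ S} := fun y => by
    have : Measurable fun t : ℝ => B *ᵥ y + t • d := by fun_prop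
    exact this hS
  rw [hlaw (s⁻¹ + c).toNNReal (N := M') (by rw [hr', hM', add_sub_cancel_left]),
    hlaw s⁻¹.toNNReal (N := M) (by rw [hr, sub_self, zero_smul, add_zero]),
    ← lintegral_const_mul' _ _ ENNReal.ofReal_ne_top]
  calc _ ≤ ∫⁻ y, (ENNReal.ofReal (Real.exp ε) *
              gaussianReal 0 s⁻¹.toNNReal {t | B *ᵥ y + t • d ∈ S} +
            ENNReal.ofReal (2 * Real.exp (-(ε / (c * s))))) ∂stdGaussianPi κ := by
        refine lintegral_mono fun y => ?_
        have := gaussianReal_le_exp_mul_add hr0 hlt hε (hmeas y)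
        rwa [hr, hr', hexp] at this
    _ = _ := by rw [lintegral_add_right _ measurable_const]; simp

lemma sum_pairs_eq {n : ℕ} {f : Fin n → Fin n → ℝ} (hsymm : ∀ u v, f u v = f v u)
    (hdiag : ∀ u, f u u = 0) :
    2 * ∑ p : Pairs n, f p.1.1 p.1.2 = ∑ u, ∑ v, f u v := by
  have hpairs : ∑ p : Pairs n, f p.1.1 p.1.2 = ∑ u, ∑ v, if u < v then f u v else 0 := by
    rw [← Fintype.sum_prod_type' (f := fun u v => if u < v then f u v else 0),
      ← Finset.sum_filter]
    exact (Finset.sum_subtype _ (by simp) fun p : Fin n × Fin n => f p.1 p.2).symm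
  have hsplit : ∀ u v, f u v = (if u < v then f u v else 0) + if v < u then f v u else 0 := by
    intro u v
    rcases lt_trichotomy u v with h | rfl | h
    · simp [h, h.not_gt]
    · simp [hdiag]
    · simp [h, h.not_gt, hsymm u v]
  simp_rw [two_mul, hpairs]
  conv_rhs => enter [2, u, 2, v]; rw [hsplit u v]
  simp_rw [Finset.sum_add_distrib]
  congr 1
  exact Finset.sum_comm

lemma sum_pairs_sub_sq {n : ℕ} (x : Fin n → ℝ) :
    ∑ p : Pairs n, (x p.1.1 - x p.1.2) ^ 2 = n * ∑ u, x u ^ 2 - (∑ u, x u) ^ 2 := by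
  have h := sum_pairs_eq (f := fun u v => (x u - x v) ^ 2) (fun u v => by ring) (by simp)
  have h' : ∑ u, ∑ v, (x u - x v) ^ 2 = 2 * (n * ∑ u, x u ^ 2 - (∑ u, x u) ^ 2) := by
    simp_rw [sub_sq, Finset.sum_add_distrib, Finset.sum_sub_distrib, mul_assoc, ← Finset.mul_sum,
      ← Finset.sum_mul]
    simp [← Finset.mul_sum]
    ring
  linarith

lemma edgeMatrix_apply {n : ℕ} (ω : Fin n → Fin n → ℝ) (p : Pairs n) (x : Fin n) :
    edgeMatrix ω p x = √(ω p.1.1 p.1.2) *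
      (Pi.single p.1.1 1 - Pi.single p.1.2 1 : Fin n → ℝ) x := by
  have hp : p.1.1 ≠ p.1.2 := p.2.ne
  simp only [edgeMatrix, Matrix.of_apply, Pi.sub_apply, Pi.single_apply]
  congr 1
  split_ifs <;> simp_all

lemma edgeMatrix_mulVec {n : ℕ} (ω : Fin n → Fin n → ℝ) (x : Fin n → ℝ) (p : Pairs n) :
    (edgeMatrix ω *ᵥ x) p = √(ω p.1.1 p.1.2) * (x p.1.1 - x p.1.2) := by
  have : edgeMatrix ω p =
      √(ω p.1.1 p.1.2) • (Pi.single p.1.1 1 - Pi.single p.1.2 1 : Fin n → ℝ) :=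
    funext (edgeMatrix_apply ω p)
  rw [Matrix.mulVec, this, smul_dotProduct, sub_dotProduct]
  simp

lemma edgeMatrix_transpose_mul {n : ℕ} {ω : Fin n → Fin n → ℝ} (hpos : ∀ u v, 0 ≤ ω u v) :
    (edgeMatrix ω)ᵀ * edgeMatrix ω = ∑ p : Pairs n, ω p.1.1 p.1.2 •
      Matrix.vecMulVec (Pi.single p.1.1 1 - Pi.single p.1.2 1 : Fin n → ℝ)
        (Pi.single p.1.1 1 - Pi.single p.1.2 1) := by
  ext x y
  simp_rw [Matrix.sum_apply, Matrix.mul_apply, Matrix.transpose_apply, edgeMatrix_apply,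
    Matrix.smul_apply, Matrix.vecMulVec_apply, smul_eq_mul, mul_mul_mul_comm,
    Real.mul_self_sqrt (hpos _ _)]

lemma edgeMatrix_transpose_mul_add {n : ℕ} {ω ω' : Fin n → Fin n → ℝ} (hpos : ∀ u v, 0 ≤ ω u v)
    (hpos' : ∀ u v, 0 ≤ ω' u v) {a b : Fin n} (hab : a < b) {c : ℝ}
    (hagree : ∀ u v, ({u, v} : Finset (Fin n)) ≠ {a, b} → ω' u v = ω u v)
    (hab' : ω' a b = ω a b + c) :
    (edgeMatrix ω')ᵀ * edgeMatrix ω' = (edgeMatrix ω)ᵀ * edgeMatrix ω +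
      c • Matrix.vecMulVec (Pi.single a 1 - Pi.single b 1 : Fin n → ℝ)
        (Pi.single a 1 - Pi.single b 1) := by
  rw [← sub_eq_iff_eq_add', edgeMatrix_transpose_mul hpos, edgeMatrix_transpose_mul hpos',
    ← Finset.sum_sub_distrib]
  simp_rw [← sub_smul]
  rw [Finset.sum_eq_single (⟨(a, b), hab⟩ : Pairs n) ?_ (by simp), hab', add_sub_cancel_left]
  intro p _ hp
  rw [hagree, sub_self, zero_smul]
  intro heq
  refine hp (Subtype.ext (Prod.ext_iff.mpr ?_))
  have hlt := p.2
  have h1 : p.1.1 ∈ ({a, b} : Finset (Fin n)) := heq ▸ by simp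
  have h2 : p.1.2 ∈ ({a, b} : Finset (Fin n)) := heq ▸ by simp
  simp only [Finset.mem_insert, Finset.mem_singleton] at h1 h2
  dsimp only
  omega

lemma le_dotProduct_edgeMatrix_mulVec {n : ℕ} {ω : Fin n → Fin n → ℝ} {t : ℝ} (ht : 0 ≤ t)
    (hlb : ∀ u v, u ≠ v → t ≤ ω u v) (x : Fin n → ℝ) :
    t * (n * ∑ u, x u ^ 2 - (∑ u, x u) ^ 2) ≤
      x ⬝ᵥ ((edgeMatrix ω)ᵀ * edgeMatrix ω) *ᵥ x := by
  rw [← Matrix.mulVec_mulVec, Matrix.dotProduct_mulVec, Matrix.vecMul_transpose, dotProduct,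
    ← sum_pairs_sub_sq, Finset.mul_sum]
  refine Finset.sum_le_sum fun p _ => ?_
  have hp := hlb _ _ p.2.ne
  rw [edgeMatrix_mulVec, ← sq, mul_pow, Real.sq_sqrt (ht.trans hp)]
  gcongr

/-- The potential `v` induced by a unit flow from `a` to `b`, whose potential difference is the
effective resistance between `a` and `b`. -/
lemma exists_edgeMatrix_mulVec_eq {n : ℕ} {w : ℝ} (hw : 0 < w) (hwn : w ≤ n)
    {ω : Fin n → Fin n → ℝ} (hlb : ∀ u v, u ≠ v → w / n ≤ ω u v) {a b : Fin n} (hab : a ≠ b) :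
    ∃ v : Fin n → ℝ,
      ((edgeMatrix ω)ᵀ * edgeMatrix ω) *ᵥ v = Pi.single a 1 - Pi.single b 1 ∧
      0 < v ⬝ᵥ (Pi.single a 1 - Pi.single b 1) ∧
      v ⬝ᵥ (Pi.single a 1 - Pi.single b 1) ≤ 2 / w := by
  set L := (edgeMatrix ω)ᵀ * edgeMatrix ω with hL
  set d : Fin n → ℝ := Pi.single a 1 - Pi.single b 1 with hd
  have hn : (0 : ℝ) < n := hw.trans_le hwn
  have hquad := le_dotProduct_edgeMatrix_mulVec (ω := ω) (by positivity : 0 ≤ w / n) hlb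
  have hone : (1 : Fin n → ℝ) ᵥ* L = 0 := by
    rw [← Matrix.mulVec_transpose, hL, Matrix.transpose_mul, Matrix.transpose_transpose,
      ← Matrix.mulVec_mulVec]
    have : edgeMatrix ω *ᵥ 1 = 0 := by ext p; simp [edgeMatrix_mulVec]
    rw [this, Matrix.mulVec_zero]
  set K := L + Matrix.vecMulVec 1 1 with hK
  have hinj : Function.Injective K.mulVec := by
    rw [← Matrix.coe_mulVecLin, injective_iff_map_eq_zero]
    intro x hx
    have hx' : x ⬝ᵥ L *ᵥ x + (∑ u, x u) ^ 2 = 0 := by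
      have : x ⬝ᵥ K *ᵥ x = 0 := by
        rw [← Matrix.mulVecLin_apply, hx, dotProduct_zero]
      rw [hK, Matrix.add_mulVec, dotProduct_add, Matrix.vecMulVec_mulVec] at this
      simpa [dotProduct, Finset.sum_mul, ← Finset.mul_sum, sq] using this
    have h1 := hquad x
    have h2 : w / n * (∑ u, x u) ^ 2 ≤ (∑ u, x u) ^ 2 :=
      mul_le_of_le_one_left (sq_nonneg _) ((div_le_one hn).mpr hwn)
    have h3 : w / n * (n * ∑ u, x u ^ 2) = w * ∑ u, x u ^ 2 := by field_simp
    have h4 : w * ∑ u, x u ^ 2 ≤ 0 := by linarith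
    have h5 : ∑ u, x u ^ 2 = 0 :=
      le_antisymm (nonpos_of_mul_nonpos_right h4 hw) (Finset.sum_nonneg fun _ _ => sq_nonneg _)
    ext u
    simpa using (Finset.sum_eq_zero_iff_of_nonneg fun _ _ => sq_nonneg _).mp h5 u
      (Finset.mem_univ u)
  obtain ⟨v, hv⟩ := Matrix.mulVec_surjective_iff_isUnit.mpr
    (Matrix.mulVec_injective_iff_isUnit.mp hinj) d
  have hsum : ∑ u, v u = 0 := by
    have h := congrArg ((1 : Fin n → ℝ) ⬝ᵥ ·) hv
    simp only [hK, Matrix.add_mulVec, dotProduct_add, Matrix.dotProduct_mulVec, hone,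
      Matrix.vecMul_vecMulVec, hd, dotProduct_sub] at h
    simpa [dotProduct, hn.ne', ← Finset.mul_sum] using h
  have hLv : L *ᵥ v = d := by
    rw [hK, Matrix.add_mulVec, Matrix.vecMulVec_mulVec] at hv
    simpa [dotProduct, hsum] using hv
  have hlow : w * ∑ u, v u ^ 2 ≤ v ⬝ᵥ d := by
    have h := hquad v
    rw [hsum, ← hL, hLv] at h
    refine le_of_eq_of_le ?_ h
    field_simp
    ring
  have hval : v ⬝ᵥ d = v a - v b := by simp [hd, dotProduct_sub]
  have hsq : v a ^ 2 + v b ^ 2 ≤ ∑ u, v u ^ 2 := by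
    rw [← Finset.sum_pair (f := fun u => v u ^ 2) hab]
    exact Finset.sum_le_sum_of_subset_of_nonneg (Finset.subset_univ _) fun _ _ _ => sq_nonneg _
  have hpos : 0 < v ⬝ᵥ d := by
    have hv2 : 0 ≤ ∑ u, v u ^ 2 := Finset.sum_nonneg fun _ _ => sq_nonneg _
    rcases hv2.eq_or_lt with h | h
    · have hv0 : v = 0 := funext fun u => by
        simpa using (Finset.sum_eq_zero_iff_of_nonneg fun _ _ => sq_nonneg _).mp h.symm u
          (Finset.mem_univ u)
      have := congrFun hLv a
      simp [hv0, hd, hab] at this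
    · exact (mul_pos hw h).trans_le hlow
  refine ⟨v, hLv, hpos, ?_⟩
  rw [le_div_iff₀ hw]
  have h1 : (v ⬝ᵥ d) ^ 2 ≤ 2 * (v a ^ 2 + v b ^ 2) := by
    rw [hval]; nlinarith [sq_nonneg (v a + v b)]
  have h2 : w * (v ⬝ᵥ d) ^ 2 ≤ 2 * v ⬝ᵥ d := by nlinarith
  nlinarith

/-- Claim 3.3, inequality (2), measure form: approximate density domination in the other
direction for a single Gaussian projection of a graph. -/
theorem gaussian_projection_approx_domination {n : ℕ} (hn : 2 ≤ n) {w : ℝ}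
    (hw2 : 2 ≤ w) (hwn : w ≤ n / 2) {ε₀ δ₀ : ℝ}
    (hε₀ : 0 < ε₀) (hδ₀ : 0 < δ₀ ∧ δ₀ < 1)
    (hcond : 8 * Real.log (4 / δ₀) / w ≤ ε₀)
    {ω ω' : Fin n → Fin n → ℝ}
    (hsym : ∀ u v, ω u v = ω v u) (hdiag : ∀ u, ω u u = 0) (hpos : ∀ u v, 0 ≤ ω u v)
    (hsym' : ∀ u v, ω' u v = ω' v u) (hdiag' : ∀ u, ω' u u = 0) (hpos' : ∀ u v, 0 ≤ ω' u v)
    (hlb : ∀ u v, u ≠ v → w / n ≤ ω u v)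
    {a b : Fin n} (hab : a ≠ b) {c : ℝ} (hc : 0 < c) (hc1 : c ≤ 1)
    (hagree : ∀ u v, ({u, v} : Finset (Fin n)) ≠ {a, b} → ω' u v = ω u v)
    (hab' : ω' a b = ω a b + c)
    {S : Set (Fin n → ℝ)} (hS : MeasurableSet S) :
    Measure.map (fun y : Pairs n → ℝ => (edgeMatrix ω')ᵀ *ᵥ y) (stdGaussianPi (Pairs n)) S
    ≤ ENNReal.ofReal (Real.exp ε₀) *
        Measure.map (fun y : Pairs n → ℝ => (edgeMatrix ω)ᵀ *ᵥ y) (stdGaussianPi (Pairs n)) S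
      + ENNReal.ofReal δ₀ := by
  wlog hlt : a < b generalizing a b
  · refine this hab.symm (fun u v h => hagree u v ?_) (by rw [hsym', hsym, hab'])
      (lt_of_le_of_ne (not_lt.mp hlt) hab.symm)
    rwa [Finset.pair_comm a b]
  have hw : 0 < w := by linarith
  obtain ⟨v, hv, hs, hs2⟩ := exists_edgeMatrix_mulVec_eq hw (by linarith) hlb hab
  have hle := map_mulVec_stdGaussianPi_le (M := (edgeMatrix ω)ᵀ) (M' := (edgeMatrix ω')ᵀ)
    (by rwa [Matrix.transpose_transpose]) hs hc hε₀.le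
    (by simpa only [Matrix.transpose_transpose] using
      edgeMatrix_transpose_mul_add hpos hpos' hlt hagree hab') hS
  refine hle.trans ?_
  gcongr
  set s := v ⬝ᵥ (Pi.single a 1 - Pi.single b 1)
  have hlog : 0 ≤ Real.log (4 / δ₀) :=
    Real.log_nonneg (by rw [le_div_iff₀ hδ₀.1]; linarith [hδ₀.2])
  have hcs : c * s ≤ 2 / w := (mul_le_of_le_one_left hs.le hc1).trans hs2
  have hbound : Real.log (4 / δ₀) ≤ ε₀ / (c * s) := by
    rw [le_div_iff₀ (mul_pos hc hs)]
    calc Real.log (4 / δ₀) * (c * s) ≤ Real.log (4 / δ₀) * (2 / w) := by gcongr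
      _ ≤ 8 * Real.log (4 / δ₀) / w := by
        rw [mul_div_assoc', mul_comm]
        gcongr
        norm_num
      _ ≤ ε₀ := hcond
  have hexp : Real.exp (-(ε₀ / (c * s))) ≤ δ₀ / 4 := by
    calc Real.exp (-(ε₀ / (c * s))) ≤ Real.exp (-Real.log (4 / δ₀)) := by gcongr
      _ = δ₀ / 4 := by rw [Real.exp_neg, Real.exp_log (by have := hδ₀.1; positivity), inv_div]
  linarith [hδ₀.1]
end
end

section
/- Per-sample privacy for the shifted covariance matrix (Claim 4.4, Stage 2, measure form): Let n, d be positive integers, w ≥ 2, and let ε₀ > 0, δ₀ ∈ (0,1) satisfy ε₀ ≥ 32·ln(8/δ₀)/w. Let A, A′ be n×d real matrices with A′ = A + e_i vᵀ for some index i and unit vector v ∈ ℝ^d. Set B = (AᵀA + w²·I_d)^{1/2} and B′ = (A′ᵀA′ + w²·I_d)^{1/2}, and let ν_A (resp. ν_{A′}) be the pushforward of the standard Gaussian measure γ_d on ℝ^d under y ↦ B·y (resp. y ↦ B′·y). Then for every measurable set S ⊆ ℝ^d, ν_A(S) ≤ e^{ε₀}·ν_{A′}(S) + δ₀ and ν_{A′}(S)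 ≤ e^{ε₀}·ν_A(S) + δ₀. -/
open MeasureTheory ProbabilityTheory Matrix

noncomputable section

section CharacteristicFunctions

lemma integral_cexp_gaussianReal (c : ℝ) :
    ∫ x, Complex.exp (((c * x : ℝ) : ℂ) * Complex.I) ∂(gaussianReal 0 1)
      = Complex.exp (((-(c * c) / 2 : ℝ) : ℂ)) := by
  have h := charFun_gaussianReal (μ := 0) (v := 1) c
  rw [charFun_apply_real] at h
  push_cast
  rw [h]
  congr 1
  push_cast
  ring

lemma integral_cexp_dotProduct_stdGaussianPi {ι : Type*} [Fintype ι] (c : ι → ℝ) :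
    ∫ y, Complex.exp (((c ⬝ᵥ y : ℝ) : ℂ) * Complex.I) ∂(stdGaussianPi ι)
      = Complex.exp (((-(c ⬝ᵥ c) / 2 : ℝ) : ℂ)) := by
  have h : ∀ y : ι → ℝ, Complex.exp (((c ⬝ᵥ y : ℝ) : ℂ) * Complex.I)
      = ∏ i, Complex.exp (((c i * y i : ℝ) : ℂ) * Complex.I) := by
    intro y
    rw [← Complex.exp_sum, ← Finset.sum_mul, ← Complex.ofReal_sum]
    rfl
  simp_rw [h]
  rw [stdGaussianPi, integral_fintype_prod_eq_prod
    (fun i (x : ℝ) => Complex.exp (((c i * x : ℝ) : ℂ) * Complex.I))]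
  simp_rw [integral_cexp_gaussianReal]
  rw [← Complex.exp_sum, ← Complex.ofReal_sum]
  simp only [dotProduct, neg_div, Finset.sum_neg_distrib, Finset.sum_div]

/-- Two linear images of standard Gaussian measures with the same covariance agree. -/
lemma map_mulVec_stdGaussianPi_eq_map_prod {m κ ι : Type*} [Fintype m] [Fintype κ] [Fintype ι]
    {B : Matrix m κ ℝ} {C : Matrix m ι ℝ} {a b : m → ℝ}
    (h : B * Bᵀ = vecMulVec a a + C * Cᵀ + vecMulVec b b) :
    Measure.map (fun y => B *ᵥ y) (stdGaussianPi κ)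
      = Measure.map (fun p : (ℝ × (ι → ℝ)) × ℝ => p.1.1 • a + C *ᵥ p.1.2 + p.2 • b)
        (((gaussianReal 0 1).prod (stdGaussianPi ι)).prod (gaussianReal 0 1)) := by
  classical
  have hB : Continuous fun y : κ → ℝ => B *ᵥ y := by fun_prop
  have hF : Continuous fun p : (ℝ × (ι → ℝ)) × ℝ => p.1.1 • a + C *ᵥ p.1.2 + p.2 • b := by
    fun_prop
  have := Measure.isProbabilityMeasure_map (μ := stdGaussianPi κ) hB.aemeasurable
  have := Measure.isProbabilityMeasure_map
    (μ := ((gaussianReal 0 1).prod (stdGaussianPi ι)).prod (gaussianReal 0 1)) hF.aemeasurable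
  refine Measure.ext_of_charFunDual ?_
  ext L
  obtain ⟨l, hl⟩ : ∃ l : m → ℝ, ∀ x, L x = l ⬝ᵥ x := by
    refine ⟨fun j => L (Pi.single j 1), fun x => ?_⟩
    conv_lhs => rw [← Finset.univ_sum_single x]
    rw [map_sum]
    refine Finset.sum_congr rfl fun j _ => ?_
    rw [mul_comm, ← smul_eq_mul, ← map_smul, ← Pi.single_smul, smul_eq_mul, mul_one]
  rw [charFunDual_apply, charFunDual_apply, integral_map hB.aemeasurable (by fun_prop),
    integral_map hF.aemeasurable (by fun_prop)]
  have h1 : ∀ p : (ℝ × (ι → ℝ)) × ℝ,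
      Complex.exp ((L (p.1.1 • a + C *ᵥ p.1.2 + p.2 • b) : ℂ) * Complex.I)
        = (Complex.exp ((((l ⬝ᵥ a) * p.1.1 : ℝ) : ℂ) * Complex.I)
          * Complex.exp ((((l ᵥ* C) ⬝ᵥ p.1.2 : ℝ) : ℂ) * Complex.I))
          * Complex.exp ((((l ⬝ᵥ b) * p.2 : ℝ) : ℂ) * Complex.I) := by
    intro p
    rw [← Complex.exp_add, ← Complex.exp_add, ← add_mul, ← add_mul, ← Complex.ofReal_add,
      ← Complex.ofReal_add, hl, dotProduct_add, dotProduct_add, dotProduct_smul, dotProduct_smul,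
      dotProduct_mulVec, smul_eq_mul, smul_eq_mul, mul_comm (l ⬝ᵥ a), mul_comm (l ⬝ᵥ b)]
  simp_rw [h1]
  rw [integral_prod_mul (fun q : ℝ × (ι → ℝ) =>
      Complex.exp ((((l ⬝ᵥ a) * q.1 : ℝ) : ℂ) * Complex.I)
        * Complex.exp ((((l ᵥ* C) ⬝ᵥ q.2 : ℝ) : ℂ) * Complex.I))
      (fun x : ℝ => Complex.exp ((((l ⬝ᵥ b) * x : ℝ) : ℂ) * Complex.I)),
    integral_prod_mul (fun x : ℝ => Complex.exp ((((l ⬝ᵥ a) * x : ℝ) : ℂ) * Complex.I))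
      (fun y : ι → ℝ => Complex.exp ((((l ᵥ* C) ⬝ᵥ y : ℝ) : ℂ) * Complex.I))]
  simp_rw [hl, dotProduct_mulVec]
  rw [integral_cexp_gaussianReal, integral_cexp_gaussianReal,
    integral_cexp_dotProduct_stdGaussianPi, integral_cexp_dotProduct_stdGaussianPi,
    ← Complex.exp_add, ← Complex.exp_add, ← Complex.ofReal_add, ← Complex.ofReal_add]
  have key : (l ᵥ* B) ⬝ᵥ (l ᵥ* B)
      = (l ⬝ᵥ a) * (l ⬝ᵥ a) + (l ᵥ* C) ⬝ᵥ (l ᵥ* C) + (l ⬝ᵥ b) * (l ⬝ᵥ b) := by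
    have hq := congrArg (fun M : Matrix m m ℝ => l ⬝ᵥ M *ᵥ l) h
    simpa [add_mulVec, dotProduct_add, ← mulVec_mulVec, dotProduct_mulVec, mulVec_transpose,
      vecMulVec_mulVec, vecMul_vecMulVec, dotProduct_comm a l, dotProduct_comm b l] using hq
  rw [key]
  congr 2
  ring

end CharacteristicFunctions

section GaussianShift

/-- The privacy loss of a unit-variance Gaussian under a shift of its mean. -/
lemma gaussianReal_apply_le_exp_mul_add (t ε : ℝ) (E : Set ℝ) :
    gaussianReal 0 1 E ≤ ENNReal.ofReal (Real.exp ε) * gaussianReal t 1 E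
      + gaussianReal 0 1 {x | ε < t ^ 2 / 2 - t * x} := by
  have hbad : MeasurableSet {x : ℝ | ε < t ^ 2 / 2 - t * x} :=
    measurableSet_lt (by fun_prop) (by fun_prop)
  refine (measure_le_inter_add_sdiff _ E {x | ε < t ^ 2 / 2 - t * x}).trans ?_
  rw [add_comm]
  refine add_le_add ?_ (measure_mono Set.inter_subset_right)
  refine le_trans ?_ (mul_le_mul_right (measure_mono (Set.sdiff_subset (s := E)
    (t := {x | ε < t ^ 2 / 2 - t * x}))) _)
  rw [gaussianReal_apply _ one_ne_zero, gaussianReal_apply _ one_ne_zero,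
    ← lintegral_const_mul _ (measurable_gaussianPDF _ _)]
  refine setLIntegral_mono (by fun_prop) fun x hx => ?_
  have hx2 : t ^ 2 / 2 - t * x ≤ ε := not_lt.mp hx.2
  rw [gaussianPDF, gaussianPDF, ← ENNReal.ofReal_mul (Real.exp_nonneg _)]
  refine ENNReal.ofReal_le_ofReal ?_
  rw [gaussianPDFReal, gaussianPDFReal, mul_left_comm, ← Real.exp_add]
  gcongr
  simp only [NNReal.coe_one]
  nlinarith

lemma gaussianReal_abs_ge_le {s : ℝ} (hs : 0 ≤ s) :
    gaussianReal 0 1 {x | s ≤ |x|} ≤ ENNReal.ofReal (2 * Real.exp (-s ^ 2 / 2)) := by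
  have hright : (gaussianReal 0 1).real {x | s ≤ x} ≤ Real.exp (-s ^ 2 / 2) := by
    have h := measure_ge_le_exp_mul_mgf (μ := gaussianReal 0 1) (X := id) s hs
      (integrable_exp_mul_gaussianReal s)
    rw [mgf_id_gaussianReal, ← Real.exp_add] at h
    refine h.trans (Real.exp_le_exp.mpr (le_of_eq ?_))
    simp only [NNReal.coe_one]
    ring
  have hleft : (gaussianReal 0 1).real {x | x ≤ -s} ≤ Real.exp (-s ^ 2 / 2) := by
    have h := measure_le_le_exp_mul_mgf (μ := gaussianReal 0 1) (X := id) (t := -s) (-s)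
      (by linarith) (integrable_exp_mul_gaussianReal (-s))
    rw [mgf_id_gaussianReal, ← Real.exp_add] at h
    refine h.trans (Real.exp_le_exp.mpr (le_of_eq ?_))
    simp only [NNReal.coe_one]
    ring
  rw [← ofReal_measureReal]
  refine ENNReal.ofReal_le_ofReal ?_
  calc (gaussianReal 0 1).real {x | s ≤ |x|}
      ≤ (gaussianReal 0 1).real ({x | s ≤ x} ∪ {x | x ≤ -s}) := by
        refine measureReal_mono fun x hx => ?_
        rcases le_abs.mp (Set.mem_ofPred.mp hx) with h | h
        · exact Or.inl h
        · exact Or.inr (le_neg_of_le_neg h)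
    _ ≤ _ := measureReal_union_le _ _
    _ ≤ 2 * Real.exp (-s ^ 2 / 2) := by linarith

/-- Privacy of a unit-variance Gaussian shifted by `g / w`, with `g` itself standard Gaussian
and independent of an auxiliary variable with law `μ`. -/
lemma prod_gaussianReal_shift_le {Ω : Type*} [MeasurableSpace Ω] (μ : Measure Ω)
    [IsProbabilityMeasure μ] {w ε δ : ℝ} (hw : 2 ≤ w) (hδ : 0 < δ) (hδ1 : δ < 1)
    (hε : 32 * Real.log (8 / δ) / w ≤ ε) {E : Set ((ℝ × Ω) × ℝ)} (hE : MeasurableSet E) :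
    (((gaussianReal 0 1).prod μ).prod (gaussianReal 0 1)) E
      ≤ ENNReal.ofReal (Real.exp ε) * (((gaussianReal 0 1).prod μ).prod (gaussianReal 0 1))
          ((fun p => (p.1, p.2 + p.1.1 / w)) ⁻¹' E) + ENNReal.ofReal δ := by
  set l := Real.log (8 / δ) with hl
  have hl0 : 0 < l := Real.log_pos (by rw [lt_div_iff₀ hδ]; linarith)
  set T : Set ℝ := {x | 4 * √l ≤ |x|}
  have hTm : MeasurableSet T := measurableSet_le (by fun_prop) (by fun_prop)
  have hT : gaussianReal 0 1 T ≤ ENNReal.ofReal (δ / 2) := by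
    refine (gaussianReal_abs_ge_le (by positivity)).trans (ENNReal.ofReal_le_ofReal ?_)
    have h1 : Real.exp (-(4 * √l) ^ 2 / 2) ≤ Real.exp (-l) := by
      refine Real.exp_le_exp.mpr ?_
      rw [neg_div, mul_pow, Real.sq_sqrt hl0.le]
      linarith
    have h2 : Real.exp (-l) = δ / 8 := by
      rw [hl, Real.exp_neg, Real.exp_log (by positivity), inv_div]
    linarith
  have hbad : ∀ g : ℝ, g ∉ T → {x | ε < (g / w) ^ 2 / 2 - g / w * x} ⊆ T := by
    intro g hg x hx
    by_contra hxT
    have sq_lt : ∀ y : ℝ, y ∉ T → y ^ 2 < 16 * l := by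
      intro y hy
      have hy' : |y| < 4 * √l := not_le.mp hy
      have := pow_lt_pow_left₀ hy' (abs_nonneg y) two_ne_zero
      rw [sq_abs, mul_pow, Real.sq_sqrt hl0.le] at this
      linarith
    have hg2 := sq_lt g hg
    have hx2 := sq_lt x hxT
    have hw0 : 0 < w := by linarith
    have hlt : 32 * l / w < (g / w) ^ 2 / 2 - g / w * x := hε.trans_lt hx
    have heq : (g / w) ^ 2 / 2 - g / w * x = (g ^ 2 / w / 2 - g * x) / w := by
      field_simp
    rw [heq, div_lt_div_iff_of_pos_right hw0] at hlt
    have hgw : g ^ 2 / w ≤ g ^ 2 / 2 := by gcongr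
    nlinarith [sq_nonneg (g + x)]
  have hshift : Measurable fun p : (ℝ × Ω) × ℝ => (p.1, p.2 + p.1.1 / w) := by fun_prop
  rw [Measure.prod_apply hE, Measure.prod_apply (hshift hE)]
  have hpt : ∀ q : ℝ × Ω, gaussianReal 0 1 (Prod.mk q ⁻¹' E)
      ≤ ENNReal.ofReal (Real.exp ε) * gaussianReal 0 1
          (Prod.mk q ⁻¹' ((fun p : (ℝ × Ω) × ℝ => (p.1, p.2 + p.1.1 / w)) ⁻¹' E))
        + (ENNReal.ofReal (δ / 2) + (Prod.fst ⁻¹' T).indicator 1 q) := by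
    intro q
    have hm : MeasurableSet (Prod.mk q ⁻¹' E) := measurable_prodMk_left hE
    refine (gaussianReal_apply_le_exp_mul_add (q.1 / w) ε _).trans (add_le_add (le_of_eq ?_) ?_)
    · have := gaussianReal_map_add_const (μ := 0) (v := 1) (q.1 / w)
      rw [zero_add] at this
      rw [← this, Measure.map_apply (by fun_prop) hm]
      rfl
    · by_cases hq : q.1 ∈ T
      · refine prob_le_one.trans (le_add_left (le_of_eq ?_))
        simp [hq]
      · exact ((measure_mono (hbad _ hq)).trans hT).trans le_self_add
  refine (lintegral_mono hpt).trans ?_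
  have hmeas : Measurable fun q : ℝ × Ω => gaussianReal 0 1
      (Prod.mk q ⁻¹' ((fun p : (ℝ × Ω) × ℝ => (p.1, p.2 + p.1.1 / w)) ⁻¹' E)) :=
    measurable_measure_prodMk_left (hshift hE)
  rw [lintegral_add_left (hmeas.const_mul _), lintegral_const_mul _ hmeas,
    lintegral_add_left measurable_const, lintegral_const, measure_univ, mul_one,
    lintegral_indicator_one (measurable_fst hTm),
    measurePreserving_fst.measure_preimage hTm.nullMeasurableSet]
  refine add_le_add le_rfl ((add_le_add le_rfl hT).trans (le_of_eq ?_))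
  rw [← ENNReal.ofReal_add (by positivity) (by positivity), add_halves]

end GaussianShift

lemma transpose_mul_self_eq_vecMulVec_add {n m : Type*} [Fintype n] [DecidableEq n]
    (A : Matrix n m ℝ) (i : n) :
    Aᵀ * A = vecMulVec (A i) (A i) + (A.updateRow i 0)ᵀ * A.updateRow i 0 := by
  ext p q
  simp only [mul_apply, transpose_apply, Matrix.add_apply, vecMulVec_apply]
  rw [← Finset.add_sum_erase _ _ (Finset.mem_univ i),
    ← Finset.add_sum_erase _ (fun k => A.updateRow i 0 k p * A.updateRow i 0 k q)
      (Finset.mem_univ i)]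
  simp only [updateRow_self, Pi.zero_apply, mul_zero, zero_add]
  congr 1
  refine Finset.sum_congr rfl fun k hk => ?_
  rw [updateRow_ne (Finset.ne_of_mem_erase hk)]

/-- The covariance splits into the contribution of row `i`, the direction `v`, and the rest. -/
lemma transpose_mul_self_add_smul_one_eq {n m : Type*} [Fintype n] [DecidableEq n] [Fintype m]
    [DecidableEq m] (A : Matrix n m ℝ) (i : n) {v : m → ℝ} (hv : v ⬝ᵥ v = 1) (w : ℝ) :
    Aᵀ * A + (w ^ 2) • (1 : Matrix m m ℝ)
      = vecMulVec (A i) (A i)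
        + fromCols (A.updateRow i 0)ᵀ (w • (1 - vecMulVec v v))
          * (fromCols (A.updateRow i 0)ᵀ (w • (1 - vecMulVec v v)))ᵀ
        + vecMulVec (w • v) (w • v) := by
  have hproj : (1 - vecMulVec v v) * (1 - vecMulVec v v) = 1 - vecMulVec v v := by
    rw [sub_mul, mul_sub, mul_sub, vecMulVec_mul_vecMulVec, hv]
    simp
  rw [transpose_mul_self_eq_vecMulVec_add A i, transpose_fromCols, fromCols_mul_fromRows,
    transpose_transpose, transpose_smul, transpose_sub, transpose_one, transpose_vecMulVec,
    smul_mul_smul_comm, hproj, smul_vecMulVec, vecMulVec_smul, smul_smul, ← sq, smul_sub]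
  abel

lemma map_sqrt_covariance_le {n d : ℕ} {w : ℝ}
    (hw : 2 ≤ w) {ε₀ δ₀ : ℝ} (hδ₀ : 0 < δ₀ ∧ δ₀ < 1)
    (hcond : 32 * Real.log (8 / δ₀) / w ≤ ε₀)
    {A A' : Matrix (Fin n) (Fin d) ℝ} {i : Fin n} {v : Fin d → ℝ}
    (hv : v ⬝ᵥ v = 1)
    (hA' : A' = A + Matrix.of fun k j => if k = i then v j else 0)
    {B B' : Matrix (Fin d) (Fin d) ℝ}
    (hB : B.PosSemidef)
    (hB2 : B * B = Aᵀ * A + (w ^ 2) • (1 : Matrix (Fin d) (Fin d) ℝ))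
    (hB' : B'.PosSemidef)
    (hB'2 : B' * B' = A'ᵀ * A' + (w ^ 2) • (1 : Matrix (Fin d) (Fin d) ℝ))
    {S : Set (Fin d → ℝ)} (hS : MeasurableSet S) :
    Measure.map (fun y : Fin d → ℝ => B *ᵥ y) (stdGaussianPi (Fin d)) S
      ≤ ENNReal.ofReal (Real.exp ε₀) *
          Measure.map (fun y : Fin d → ℝ => B' *ᵥ y) (stdGaussianPi (Fin d)) S
        + ENNReal.ofReal δ₀ := by
  have hrow : A' i = A i + v := by
    ext j
    simp [hA']
  have hrest : A'.updateRow i 0 = A.updateRow i 0 := by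
    ext k j
    by_cases hk : k = i
    · subst hk; simp
    · simp [hA', hk]
  have hw0 : w ≠ 0 := by linarith
  have hBt : B * Bᵀ = B * B := by rw [← conjTranspose_eq_transpose_of_trivial, hB.isHermitian.eq]
  have hBt' : B' * B'ᵀ = B' * B' := by
    rw [← conjTranspose_eq_transpose_of_trivial, hB'.isHermitian.eq]
  have hC := transpose_mul_self_add_smul_one_eq A i hv w
  have hC' := transpose_mul_self_add_smul_one_eq A' i hv w
  rw [hrow, hrest] at hC'
  set C := fromCols (A.updateRow i 0)ᵀ (w • (1 - vecMulVec v v))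
  rw [map_mulVec_stdGaussianPi_eq_map_prod ((hBt.trans hB2).trans hC),
    map_mulVec_stdGaussianPi_eq_map_prod ((hBt'.trans hB'2).trans hC'),
    Measure.map_apply (by fun_prop) hS, Measure.map_apply (by fun_prop) hS]
  have hF : Measurable fun p : (ℝ × (Fin n ⊕ Fin d → ℝ)) × ℝ =>
      p.1.1 • A i + C *ᵥ p.1.2 + p.2 • w • v := by fun_prop
  convert prod_gaussianReal_shift_le (stdGaussianPi (Fin n ⊕ Fin d)) hw hδ₀.1 hδ₀.2 hcond
    (hF hS) using 4
  rw [← Set.preimage_comp]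
  congr 1
  ext p j
  simp only [Pi.add_apply, Pi.smul_apply, smul_eq_mul, Function.comp_apply]
  field_simp
  ring

/-- Claim 4.4, Stage 2, measure form: per-sample privacy for the shifted covariance matrix. -/
theorem per_sample_covariance_privacy {n d : ℕ} (hn : 0 < n) (hd : 0 < d) {w : ℝ}
    (hw : 2 ≤ w) {ε₀ δ₀ : ℝ} (hε₀ : 0 < ε₀) (hδ₀ : 0 < δ₀ ∧ δ₀ < 1)
    (hcond : 32 * Real.log (8 / δ₀) / w ≤ ε₀)
    {A A' : Matrix (Fin n) (Fin d) ℝ} {i : Fin n} {v : Fin d → ℝ}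
    (hv : ∑ j, v j ^ 2 = 1)
    (hA' : A' = A + Matrix.of fun k j => if k = i then v j else 0)
    {B B' : Matrix (Fin d) (Fin d) ℝ}
    (hB : B.PosSemidef)
    (hB2 : B * B = Aᵀ * A + (w ^ 2) • (1 : Matrix (Fin d) (Fin d) ℝ))
    (hB' : B'.PosSemidef)
    (hB'2 : B' * B' = A'ᵀ * A' + (w ^ 2) • (1 : Matrix (Fin d) (Fin d) ℝ))
    {S : Set (Fin d → ℝ)} (hS : MeasurableSet S) :
    Measure.map (fun y : Fin d → ℝ => B *ᵥ y) (stdGaussianPi (Fin d)) S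
      ≤ ENNReal.ofReal (Real.exp ε₀) *
          Measure.map (fun y : Fin d → ℝ => B' *ᵥ y) (stdGaussianPi (Fin d)) S
        + ENNReal.ofReal δ₀ ∧
    Measure.map (fun y : Fin d → ℝ => B' *ᵥ y) (stdGaussianPi (Fin d)) S
      ≤ ENNReal.ofReal (Real.exp ε₀) *
          Measure.map (fun y : Fin d → ℝ => B *ᵥ y) (stdGaussianPi (Fin d)) S
        + ENNReal.ofReal δ₀ := by
  have hv' : v ⬝ᵥ v = 1 := by simpa only [dotProduct, sq] using hv
  refine ⟨map_sqrt_covariance_le hw hδ₀ hcond hv' hA' hB hB2 hB' hB'2 hS,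
    map_sqrt_covariance_le (v := -v) (i := i) hw hδ₀ hcond (by simpa using hv') ?_
      hB' hB'2 hB hB2 hS⟩
  ext k j
  by_cases hk : k = i <;> simp [hA', hk]
end
end
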